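/- arXiv:2112.14720 — 4 statements merged into one kernel-verified Lean document; each statement's English description precedes it below -/
import Mathlib

section
/- (Existence of zig-zag bump functions; Proposition 7.6 of del Pino–Toussaint, stated with the O(1/N) estimate in ε-form.) Fix an integer r ≥ 1, real numbers a < b, y_a, y_b, and ε > 0. Then there exist smooth functions x, z_0, z_1, …, z_r : ℝ → ℝ such that: (a) for all t ≤ a: x(t) = t, z_0(t) = y_a and z_i(t) = 0 for 1 ≤ i ≤ r; (b) for all t ≥ b: x(t) = t, z_0(t) = y_b and z_i(t) = 0 for 1 ≤ i ≤ r; (c) integrality: deriv z_i t = z_{i+1}(t) · deriv x t for all 0 ≤ i < r and all t; (d) the front t ↦ (x(t), z_0(t)) is injective on ℝ; (e) the set {t : deriv x t ≠ 0} is dense in ℝ, and at every t with deriv x t = 0 one has deriv z_r t ≠ 0 and deriv (deriv x) t ≠ 0 (fold-type tangencies, so the lift is an immersion); (f) |z_i(t)| < ε for all 1 ≤ i ≤ r and all t ∈ ℝ. -/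
open Set Function

namespace ZigZag

/-- A smooth bump, positive exactly on `(a,b)`. -/
noncomputable def bump (a b t : ℝ) : ℝ := expNegInvGlue (t - a) * expNegInvGlue (b - t)

/-- `u = κ + bump'`. -/
noncomputable def uu (a b κ t : ℝ) : ℝ := κ + deriv (bump a b) t

/-- the recursive coefficients of the lifted coordinates -/
noncomputable def GG (a b : ℝ) (r : ℕ) : ℕ → ℝ → ℝ → ℝ
  | 0 => fun _ t => bump a b t
  | j + 1 => fun κ t =>
      ((2 * (r - (j + 1)) + 1 : ℕ) : ℝ) * deriv (deriv (bump a b)) t * GG a b r j κ t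
        + uu a b κ t * deriv (GG a b r j κ) t

/-- the primitive giving `z 0` -/
noncomputable def II (a b : ℝ) (r : ℕ) (κ t : ℝ) : ℝ :=
  ∫ s in a..t, uu a b κ s ^ (2 * r) * bump a b s

/-- the lifted coordinates -/
noncomputable def zz (a b ya : ℝ) (r : ℕ) (κ C : ℝ) : ℕ → ℝ → ℝ
  | 0 => fun t => ya + C * II a b r κ t
  | j + 1 => fun t => κ ^ (j + 1) * C * (uu a b κ t ^ (2 * (r - (j + 1)) + 1) * GG a b r j κ t)

/-- the base coordinate -/
noncomputable def xx (a b κ t : ℝ) : ℝ := t + bump a b t / κ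

lemma bump_contDiff (a b : ℝ) : ContDiff ℝ (⊤ : ℕ∞) (bump a b) := by
  unfold bump
  exact (expNegInvGlue.contDiff.comp (contDiff_id.sub contDiff_const)).mul
    (expNegInvGlue.contDiff.comp (contDiff_const.sub contDiff_id))

lemma bump_zero_left {a b t : ℝ} (h : t ≤ a) : bump a b t = 0 := by
  simp [bump, expNegInvGlue.zero_of_nonpos (sub_nonpos.2 h)]

lemma bump_zero_right {a b t : ℝ} (h : b ≤ t) : bump a b t = 0 := by
  simp [bump, expNegInvGlue.zero_of_nonpos (sub_nonpos.2 h)]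

lemma bump_pos {a b t : ℝ} (h : t ∈ Ioo a b) : 0 < bump a b t :=
  mul_pos (expNegInvGlue.pos_of_pos (sub_pos.2 h.1)) (expNegInvGlue.pos_of_pos (sub_pos.2 h.2))

lemma bump_nonneg (a b t : ℝ) : 0 ≤ bump a b t :=
  mul_nonneg (expNegInvGlue.nonneg _) (expNegInvGlue.nonneg _)

lemma deriv_zero_left {f : ℝ → ℝ} (hf : Differentiable ℝ f) {a : ℝ}
    (h : ∀ t ≤ a, f t = 0) : ∀ t ≤ a, deriv f t = 0 := by
  intro t ht
  rw [← (hf t).derivWithin (uniqueDiffOn_Iic a t ht),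
    derivWithin_congr (s := Iic a) (f := fun _ => (0:ℝ)) (fun s hs => h s hs) (h t ht)]
  simp

lemma deriv_zero_right {f : ℝ → ℝ} (hf : Differentiable ℝ f) {a : ℝ}
    (h : ∀ t, a ≤ t → f t = 0) : ∀ t, a ≤ t → deriv f t = 0 := by
  intro t ht
  rw [← (hf t).derivWithin (uniqueDiffOn_Ici a t ht),
    derivWithin_congr (s := Ici a) (f := fun _ => (0:ℝ)) (fun s hs => h s hs) (h t ht)]
  simp

lemma dbump_contDiff (a b : ℝ) : ContDiff ℝ (⊤ : ℕ∞) (deriv (bump a b)) :=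
  (contDiff_infty_iff_deriv.1 (bump_contDiff a b)).2

lemma ddbump_contDiff (a b : ℝ) : ContDiff ℝ (⊤ : ℕ∞) (deriv (deriv (bump a b))) :=
  (contDiff_infty_iff_deriv.1 (dbump_contDiff a b)).2

lemma bump_diff (a b : ℝ) : Differentiable ℝ (bump a b) :=
  (contDiff_infty_iff_deriv.1 (bump_contDiff a b)).1

lemma dbump_diff (a b : ℝ) : Differentiable ℝ (deriv (bump a b)) :=
  (contDiff_infty_iff_deriv.1 (dbump_contDiff a b)).1

lemma uu_contDiff2 (a b : ℝ) : ContDiff ℝ (⊤ : ℕ∞) (uncurry (uu a b)) := by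
  have : uncurry (uu a b) = fun p : ℝ × ℝ => p.1 + deriv (bump a b) p.2 := by
    ext ⟨κ, t⟩; rfl
  rw [this]
  exact contDiff_fst.add ((dbump_contDiff a b).comp contDiff_snd)

lemma slice {G : ℝ → ℝ → ℝ} (h : ContDiff ℝ (⊤ : ℕ∞) (uncurry G)) (κ : ℝ) :
    ContDiff ℝ (⊤ : ℕ∞) (G κ) :=
  h.comp (contDiff_const.prodMk contDiff_id : ContDiff ℝ (⊤ : ℕ∞) (fun t : ℝ => (κ, t)))

lemma GG_contDiff2 (a b : ℝ) (r j : ℕ) : ContDiff ℝ (⊤ : ℕ∞) (uncurry (GG a b r j)) := by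
  induction j with
  | zero =>
    have : uncurry (GG a b r 0) = fun p : ℝ × ℝ => bump a b p.2 := by
      ext ⟨κ, t⟩; rfl
    rw [this]
    exact (bump_contDiff a b).comp contDiff_snd
  | succ j ih =>
    have hd : ContDiff ℝ (⊤ : ℕ∞) (fun p : ℝ × ℝ => deriv (GG a b r j p.1) p.2) := by
      have h1 : ContDiff ℝ (⊤ : ℕ∞) (uncurry fun (p : ℝ × ℝ) (t : ℝ) => GG a b r j p.1 t) := by
        have : (uncurry fun (p : ℝ × ℝ) (t : ℝ) => GG a b r j p.1 t)
            = uncurry (GG a b r j) ∘ fun q : (ℝ × ℝ) × ℝ => (q.1.1, q.2) := by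
          ext ⟨⟨κ, s⟩, t⟩; rfl
        rw [this]
        exact ih.comp ((contDiff_fst.comp contDiff_fst).prodMk contDiff_snd)
      have h2 := ContDiff.fderiv (n := (⊤ : ℕ∞)) h1 (contDiff_snd (𝕜 := ℝ)) (by simp)
      simpa using h2.clm_apply (contDiff_const (c := (1:ℝ)))
    have : uncurry (GG a b r (j + 1)) = fun p : ℝ × ℝ =>
        ((2 * (r - (j + 1)) + 1 : ℕ) : ℝ) * deriv (deriv (bump a b)) p.2 * uncurry (GG a b r j) p
        + uncurry (uu a b) p * deriv (GG a b r j p.1) p.2 := by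
      ext ⟨κ, t⟩; rfl
    rw [this]
    exact ((contDiff_const.mul ((ddbump_contDiff a b).comp contDiff_snd)).mul ih).add
      ((uu_contDiff2 a b).mul hd)

lemma diff_of {f : ℝ → ℝ} (h : ContDiff ℝ (⊤ : ℕ∞) f) : Differentiable ℝ f :=
  (contDiff_infty_iff_deriv.1 h).1

lemma GG_zero_left (a b : ℝ) (r j : ℕ) (κ : ℝ) : ∀ t ≤ a, GG a b r j κ t = 0 := by
  induction j with
  | zero => intro t ht; exact bump_zero_left ht
  | succ j ih =>
    intro t ht
    simp only [GG]
    rw [ih t ht, deriv_zero_left (diff_of (slice (GG_contDiff2 a b r j) κ)) ih t ht]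
    simp

lemma GG_zero_right (a b : ℝ) (r j : ℕ) (κ : ℝ) : ∀ t, b ≤ t → GG a b r j κ t = 0 := by
  induction j with
  | zero => intro t ht; exact bump_zero_right ht
  | succ j ih =>
    intro t ht
    simp only [GG]
    rw [ih t ht, deriv_zero_right (diff_of (slice (GG_contDiff2 a b r j) κ)) ih t ht]
    simp

lemma GG_ne_zero (a b : ℝ) (r j : ℕ) (κ t : ℝ) (ht : t ∈ Ioo a b) (hu : uu a b κ t = 0)
    (hd : deriv (deriv (bump a b)) t ≠ 0) : GG a b r j κ t ≠ 0 := by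
  induction j with
  | zero => exact (bump_pos ht).ne'
  | succ j ih =>
    simp only [GG, hu, zero_mul, add_zero]
    exact mul_ne_zero (mul_ne_zero (by positivity) hd) ih

lemma uu_hasDerivAt (a b κ t : ℝ) :
    HasDerivAt (uu a b κ) (deriv (deriv (bump a b)) t) t :=
  ((dbump_diff a b t).hasDerivAt).const_add κ

lemma integrand_cont (a b : ℝ) (r : ℕ) (κ : ℝ) :
    ContDiff ℝ (⊤ : ℕ∞) (fun s => uu a b κ s ^ (2 * r) * bump a b s) :=
  ((slice (uu_contDiff2 a b) κ).pow _).mul (bump_contDiff a b)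

lemma II_hasDerivAt (a b : ℝ) (r : ℕ) (κ t : ℝ) :
    HasDerivAt (II a b r κ) (uu a b κ t ^ (2 * r) * bump a b t) t :=
  ((integrand_cont a b r κ).continuous.integral_hasStrictDerivAt a t).hasDerivAt

lemma II_contDiff (a b : ℝ) (r : ℕ) (κ : ℝ) : ContDiff ℝ (⊤ : ℕ∞) (II a b r κ) := by
  rw [contDiff_infty_iff_deriv]
  refine ⟨fun t => (II_hasDerivAt a b r κ t).differentiableAt, ?_⟩
  have : deriv (II a b r κ) = fun s => uu a b κ s ^ (2 * r) * bump a b s :=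
    funext fun t => (II_hasDerivAt a b r κ t).deriv
  rw [this]
  exact integrand_cont a b r κ

lemma II_left (a b : ℝ) (r : ℕ) (κ t : ℝ) (ht : t ≤ a) : II a b r κ t = 0 := by
  unfold II
  rw [intervalIntegral.integral_congr (g := fun _ => (0:ℝ))]
  · simp
  · intro s hs
    rw [uIcc_of_ge ht] at hs
    simp [bump_zero_left hs.2]

lemma II_right (a b : ℝ) (r : ℕ) (κ t : ℝ) (ht : b ≤ t) : II a b r κ t = II a b r κ b := by
  unfold II
  have hc := (integrand_cont a b r κ).continuous
  rw [← intervalIntegral.integral_add_adjacent_intervals (hc.intervalIntegrable a b)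
    (hc.intervalIntegrable b t)]
  rw [intervalIntegral.integral_congr (a := b) (b := t) (g := fun _ => (0:ℝ))]
  · simp
  · intro s hs
    rw [uIcc_of_le ht] at hs
    simp [bump_zero_right hs.1]

lemma II_lower (a b : ℝ) (hab : a < b) (r : ℕ) :
    ∃ m > 0, ∀ κ, 0 < κ → m ≤ II a b r κ b := by
  have hc : Continuous (fun s => max (deriv (bump a b) s) 0 ^ (2 * r) * bump a b s) :=
    (((dbump_contDiff a b).continuous.max continuous_const).pow _).mul
      (bump_contDiff a b).continuous
  refine ⟨∫ s in a..b, max (deriv (bump a b) s) 0 ^ (2 * r) * bump a b s, ?_, ?_⟩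
  · apply intervalIntegral.integral_pos hab hc.continuousOn
    · intro s _
      exact mul_nonneg (by positivity) (bump_nonneg a b s)
    · obtain ⟨c, hc, hd⟩ := exists_deriv_eq_slope (bump a b) (a := a) (b := (a + b) / 2)
        (by linarith) (bump_contDiff a b).continuous.continuousOn (bump_diff a b).differentiableOn
      have hpos : 0 < deriv (bump a b) c := by
        rw [hd, bump_zero_left le_rfl, sub_zero]
        exact div_pos (bump_pos ⟨by linarith, by linarith⟩) (by linarith)
      refine ⟨c, ⟨hc.1.le, by linarith [hc.2]⟩, ?_⟩
      have := bump_pos (a := a) (b := b) (t := c) ⟨hc.1, by linarith [hc.2]⟩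
      rw [max_eq_left hpos.le]
      positivity
  · intro κ hκ
    unfold II
    apply intervalIntegral.integral_mono_on hab.le (hc.intervalIntegrable _ _)
      ((integrand_cont a b r κ).continuous.intervalIntegrable _ _)
    intro s _
    refine mul_le_mul_of_nonneg_right ?_ (bump_nonneg a b s)
    rcases le_total (deriv (bump a b) s) 0 with h | h
    · rw [max_eq_right h]
      rcases Nat.eq_zero_or_pos r with rfl | hr
      · simp
      · rw [zero_pow (by omega), pow_mul]
        positivity
    · rw [max_eq_left h]
      exact pow_le_pow_left₀ h (by unfold uu; linarith) _

lemma exists_regular (a b δ : ℝ) (hδ : 0 < δ) :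
    ∃ κ, 0 < κ ∧ κ < δ ∧ ∀ t, uu a b κ t = 0 → deriv (deriv (bump a b)) t ≠ 0 := by
  have h0 : MeasureTheory.volume
      (deriv (bump a b) '' {t | deriv (deriv (bump a b)) t = 0}) = 0 := by
    apply MeasureTheory.addHaar_image_eq_zero_of_det_fderivWithin_eq_zero
      (f' := fun t => ContinuousLinearMap.toSpanSingleton ℝ (deriv (deriv (bump a b)) t))
    · intro t _
      exact ((dbump_diff a b t).hasDerivAt).hasFDerivAt.hasFDerivWithinAt
    · intro t ht
      rw [ContinuousLinearMap.det_toSpanSingleton]; exact ht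
  have h1 : ¬ (Ioo (-δ) 0 ⊆ deriv (bump a b) '' {t | deriv (deriv (bump a b)) t = 0}) := by
    intro h
    have := MeasureTheory.measure_mono_null h h0
    rw [Real.volume_Ioo, ENNReal.ofReal_eq_zero] at this
    linarith
  obtain ⟨y, hy, hy'⟩ := not_subset.1 h1
  refine ⟨-y, by linarith [hy.2], by linarith [hy.1], fun t ht hd => hy' ⟨t, hd, ?_⟩⟩
  unfold uu at ht; linarith

lemma xx_hasDerivAt (a b κ t : ℝ) (hκ : κ ≠ 0) : HasDerivAt (xx a b κ) (uu a b κ t / κ) t := by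
  have : HasDerivAt (xx a b κ) _ t := (hasDerivAt_id t).add ((bump_diff a b t).hasDerivAt.div_const κ)
  refine this.congr_deriv ?_
  unfold uu
  field_simp

lemma zz_integral (a b ya : ℝ) (r : ℕ) (κ C : ℝ) (hκ : κ ≠ 0) (i : ℕ) (hi : i < r) (t : ℝ) :
    HasDerivAt (zz a b ya r κ C i) (zz a b ya r κ C (i + 1) t * (uu a b κ t / κ)) t := by
  obtain ⟨m, rfl⟩ := Nat.exists_eq_add_of_lt hi
  rcases i with _ | j
  · have : HasDerivAt (zz a b ya (0 + m + 1) κ C 0) _ t := ((II_hasDerivAt a b (0 + m + 1) κ t).const_mul C).const_add ya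
    refine this.congr_deriv ?_
    simp only [zz, GG, show 0 + m + 1 - (0 + 1) = m by omega,
      show 2 * (0 + m + 1) = 2 * m + 2 by omega]
    field_simp
    ring
  · have hG := (diff_of (slice (GG_contDiff2 a b (j + 1 + m + 1) j) κ) t).hasDerivAt
    have : HasDerivAt (zz a b ya (j + 1 + m + 1) κ C (j + 1)) _ t := (((uu_hasDerivAt a b κ t).pow (2 * (j + 1 + m + 1 - (j + 1)) + 1)).mul hG).const_mul
      (κ ^ (j + 1) * C)
    refine this.congr_deriv ?_
    simp only [zz, GG, show j + 1 + m + 1 - (j + 1) = m + 1 by omega,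
      show j + 1 + m + 1 - (j + 1 + 1) = m by omega]
    simp only [Pi.pow_apply, show 2 * m + 3 - 1 = 2 * m + 2 by omega,
      show 2 * (m + 1) + 1 = 2 * m + 3 by omega]
    field_simp
    ring

lemma zz_contDiff (a b ya : ℝ) (r : ℕ) (κ C : ℝ) (i : ℕ) :
    ContDiff ℝ (⊤ : ℕ∞) (zz a b ya r κ C i) := by
  rcases i with _ | j
  · exact contDiff_const.add (contDiff_const.mul (II_contDiff a b r κ))
  · exact contDiff_const.mul (((slice (uu_contDiff2 a b) κ).pow _).mul
      (slice (GG_contDiff2 a b r j) κ))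

lemma zz_last (a b ya : ℝ) (r : ℕ) (hr : 1 ≤ r) (κ C : ℝ) (hκ : κ ≠ 0) (hC : C ≠ 0) (t : ℝ)
    (ht : t ∈ Ioo a b)
    (hu : uu a b κ t = 0) (hd : deriv (deriv (bump a b)) t ≠ 0) :
    deriv (zz a b ya r κ C r) t ≠ 0 := by
  obtain ⟨j, rfl⟩ := Nat.exists_eq_add_of_le' hr
  have hG := (diff_of (slice (GG_contDiff2 a b (j + 1) j) κ) t).hasDerivAt
  have h := ((uu_hasDerivAt a b κ t).mul hG).const_mul (κ ^ (j + 1) * C)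
  have he : zz a b ya (j + 1) κ C (j + 1) =
      fun s => κ ^ (j + 1) * C * ((uu a b κ * GG a b (j + 1) j κ) s) := by
    ext s; simp [zz]
  rw [he, h.deriv, hu, zero_mul, add_zero]
  exact mul_ne_zero (mul_ne_zero (pow_ne_zero _ hκ) hC)
    (mul_ne_zero hd (GG_ne_zero a b _ _ _ _ ht hu hd))

lemma uu_outside {a b κ t : ℝ} (h : t ∉ Ioo a b) : uu a b κ t = κ := by
  have : deriv (bump a b) t = 0 := by
    by_cases h1 : t ≤ a
    · exact deriv_zero_left (bump_diff a b) (fun _ h => bump_zero_left h) t h1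
    · exact deriv_zero_right (bump_diff a b) (fun _ h => bump_zero_right h) t
        (by by_contra h2; exact h ⟨not_le.1 h1, not_le.1 h2⟩)
  simp [uu, this]

lemma exists_bound (a b : ℝ) (r : ℕ) : ∃ M > 0, ∀ κ, 0 < κ → κ < 1 → ∀ j < r, ∀ t,
    |uu a b κ t ^ (2 * (r - (j + 1)) + 1) * GG a b r j κ t| ≤ M := by
  have key : ∀ j, ∃ M, 0 ≤ M ∧ ∀ κ, 0 < κ → κ < 1 → ∀ t,
      |uu a b κ t ^ (2 * (r - (j + 1)) + 1) * GG a b r j κ t| ≤ M := by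
    intro j
    have hc : Continuous fun p : ℝ × ℝ => uncurry (uu a b) p ^ (2 * (r - (j + 1)) + 1) *
        uncurry (GG a b r j) p :=
      ((uu_contDiff2 a b).continuous.pow _).mul (GG_contDiff2 a b r j).continuous
    obtain ⟨M, hM⟩ := ((isCompact_Icc (a := (0:ℝ)) (b := 1)).prod
      (isCompact_Icc (a := a) (b := b))).exists_bound_of_continuousOn hc.continuousOn
    refine ⟨max M 0, le_max_right _ _, fun κ h0 h1 t => ?_⟩
    by_cases ht : t ∈ Icc a b
    · exact (hM (κ, t) ⟨⟨h0.le, h1.le⟩, ht⟩).trans (le_max_left _ _)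
    · have : GG a b r j κ t = 0 := by
        by_cases h1 : t ≤ a
        · exact GG_zero_left a b r j κ t h1
        · refine GG_zero_right a b r j κ t ?_
          by_contra h2
          exact ht ⟨(not_le.1 h1).le, (not_le.1 h2).le⟩
      simp [this]
  choose M hM0 hM using key
  refine ⟨∑ j ∈ Finset.range r, M j + 1, ?_, ?_⟩
  · have := Finset.sum_nonneg (s := Finset.range r) (fun j _ => hM0 j)
    linarith
  · intro κ h0 h1 j hj t
    have := Finset.single_le_sum (f := M) (s := Finset.range r) (fun j _ => hM0 j)
      (Finset.mem_range.2 hj)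
    linarith [hM j κ h0 h1 t]

lemma no_interval {a b κ : ℝ}
    (hreg : ∀ t, uu a b κ t = 0 → deriv (deriv (bump a b)) t ≠ 0) {p q : ℝ} (hpq : p < q)
    (h : ∀ t ∈ Ioo p q, uu a b κ t = 0) : False := by
  have hm : (p + q) / 2 ∈ Ioo p q := ⟨by linarith, by linarith⟩
  have he : uu a b κ =ᶠ[nhds ((p + q) / 2)] fun _ => 0 := by
    filter_upwards [Ioo_mem_nhds hm.1 hm.2] with t ht using h t ht
  apply hreg _ (h _ hm)
  rw [← (uu_hasDerivAt a b κ _).deriv, he.deriv_eq]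
  simp

lemma II_mono (a b : ℝ) (r : ℕ) (κ : ℝ) : Monotone (II a b r κ) := by
  apply monotone_of_deriv_nonneg (diff_of (II_contDiff a b r κ))
  intro t
  rw [(II_hasDerivAt a b r κ t).deriv, pow_mul]
  exact mul_nonneg (by positivity) (bump_nonneg a b t)

lemma front_inj_aux {a b κ : ℝ} (hab : a < b) (r : ℕ)
    (hreg : ∀ t, uu a b κ t = 0 → deriv (deriv (bump a b)) t ≠ 0) {s t : ℝ} (hst : s < t)
    (hx : xx a b κ s = xx a b κ t) (hI : II a b r κ s = II a b r κ t) : False := by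
  by_cases h1 : t ≤ a
  · simp only [xx, bump_zero_left h1, bump_zero_left (hst.le.trans h1)] at hx
    linarith
  by_cases h2 : b ≤ s
  · simp only [xx, bump_zero_right h2, bump_zero_right (h2.trans hst.le)] at hx
    linarith
  push Not at h1 h2
  have hlt : max s a < min t b := by simp [hst, h1, h2, hab]
  refine no_interval hreg hlt ?_
  intro v hv
  have hv1 := max_lt_iff.1 hv.1
  have hv2 := lt_min_iff.1 hv.2
  have he : II a b r κ =ᶠ[nhds v] fun _ => II a b r κ s := by
    filter_upwards [Ioo_mem_nhds hv1.1 hv2.1] with w hw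
    exact le_antisymm (hI ▸ II_mono a b r κ hw.2.le) (II_mono a b r κ hw.1.le)
  have hd := (II_hasDerivAt a b r κ v).deriv
  rw [he.deriv_eq, deriv_const] at hd
  rcases mul_eq_zero.1 hd.symm with h | h
  · exact eq_zero_of_pow_eq_zero h
  · exact absurd h (bump_pos ⟨hv1.2, hv2.2⟩).ne'

end ZigZag

open ZigZag in
/-- Existence of zig-zag bump functions (del Pino–Toussaint, Proposition 7.6),
with the `O(1/N)` estimate in `ε`-form. -/
theorem zigzag_bump_function_exists
    (r : ℕ) (hr : 1 ≤ r) (a b ya yb ε : ℝ) (hab : a < b) (hε : 0 < ε) :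
    ∃ (x : ℝ → ℝ) (z : ℕ → ℝ → ℝ),
      ContDiff ℝ (⊤ : ℕ∞) x ∧ (∀ i ≤ r, ContDiff ℝ (⊤ : ℕ∞) (z i)) ∧
      -- (a) boundary condition at the left
      (∀ t ≤ a, x t = t ∧ z 0 t = ya ∧ ∀ i, 1 ≤ i → i ≤ r → z i t = 0) ∧
      -- (b) boundary condition at the right
      (∀ t, b ≤ t → x t = t ∧ z 0 t = yb ∧ ∀ i, 1 ≤ i → i ≤ r → z i t = 0) ∧
      -- (c) integrality
      (∀ i < r, ∀ t, deriv (z i) t = z (i + 1) t * deriv x t) ∧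
      -- (d) the front is injective
      Function.Injective (fun t => (x t, z 0 t)) ∧
      -- (e) graphical on a dense set, with fold-type tangencies
      Dense {t : ℝ | deriv x t ≠ 0} ∧
      (∀ t, deriv x t = 0 → deriv (z r) t ≠ 0 ∧ deriv (deriv x) t ≠ 0) ∧
      -- (f) small lifted coordinates
      (∀ i, 1 ≤ i → i ≤ r → ∀ t, |z i t| < ε) := by
  rcases eq_or_ne ya yb with rfl | hne
  · refine ⟨fun t => t, fun i _ => if i = 0 then ya else 0, contDiff_id, fun i _ => contDiff_const,
      ?_, ?_, ?_, ?_, ?_, ?_, ?_⟩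
    · intro t _
      refine ⟨rfl, rfl, fun i hi _ => ?_⟩
      simp [show i ≠ 0 by omega]
    · intro t _
      refine ⟨rfl, rfl, fun i hi _ => ?_⟩
      simp [show i ≠ 0 by omega]
    · intro i _ t
      simp
    · intro s t h
      exact (Prod.mk.inj h).1
    · simp
    · intro t h
      simp at h
    · intro i hi _ t
      simpa [show i ≠ 0 by omega] using hε
  obtain ⟨m, hm, hmI⟩ := II_lower a b hab r
  obtain ⟨M, hM, hMb⟩ := exists_bound a b r
  have hD : 0 < |yb - ya| := abs_pos.2 (sub_ne_zero.2 hne.symm)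
  obtain ⟨κ, hκ, hκδ, hreg⟩ := exists_regular a b (min 1 (ε / (|yb - ya| / m * M)))
    (by positivity)
  have hκ1 : κ < 1 := hκδ.trans_le (min_le_left _ _)
  have hκε : κ < ε / (|yb - ya| / m * M) := hκδ.trans_le (min_le_right _ _)
  have hJ : 0 < II a b r κ b := hm.trans_le (hmI κ hκ)
  set C := (yb - ya) / II a b r κ b with hCdef
  have hC : C ≠ 0 := div_ne_zero (sub_ne_zero.2 hne.symm) hJ.ne'
  have hCle : |C| ≤ |yb - ya| / m := by
    rw [hCdef, abs_div, abs_of_pos hJ]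
    exact div_le_div_of_nonneg_left (abs_nonneg _) hm (hmI κ hκ)
  have hdx : deriv (xx a b κ) = fun t => uu a b κ t / κ :=
    funext fun t => (xx_hasDerivAt a b κ t hκ.ne').deriv
  refine ⟨xx a b κ, zz a b ya r κ C, ?_, fun i _ => zz_contDiff a b ya r κ C i,
      ?_, ?_, ?_, ?_, ?_, ?_, ?_⟩
  · exact contDiff_id.add ((bump_contDiff a b).div_const κ)
  · intro t ht
    refine ⟨by simp [xx, bump_zero_left ht], by simp [zz, II_left a b r κ t ht], ?_⟩
    intro i hi _
    obtain ⟨j, rfl⟩ := Nat.exists_eq_add_of_le' hi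
    simp [zz, GG_zero_left a b r j κ t ht]
  · intro t ht
    refine ⟨by simp [xx, bump_zero_right ht], ?_, ?_⟩
    · simp only [zz, II_right a b r κ t ht, hCdef]
      field_simp
      ring
    · intro i hi _
      obtain ⟨j, rfl⟩ := Nat.exists_eq_add_of_le' hi
      simp [zz, GG_zero_right a b r j κ t ht]
  · intro i hi t
    rw [hdx, (zz_integral a b ya r κ C hκ.ne' i hi t).deriv]
  · intro s t h
    have hx : xx a b κ s = xx a b κ t := (Prod.mk.inj h).1
    have hz : ya + C * II a b r κ s = ya + C * II a b r κ t := (Prod.mk.inj h).2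
    have hI : II a b r κ s = II a b r κ t := mul_left_cancel₀ hC (add_left_cancel hz)
    rcases lt_trichotomy s t with hst | hst | hst
    · exact (front_inj_aux hab r hreg hst hx hI).elim
    · exact hst
    · exact (front_inj_aux hab r hreg hst hx.symm hI.symm).elim
  · rw [dense_iff_exists_between]
    intro p q hpq
    by_contra hcon
    push Not at hcon
    refine no_interval hreg hpq fun t ht => ?_
    by_contra hu
    refine absurd ht.2 (not_lt.2 (hcon t ?_ ht.1))
    simp [hdx, hu, hκ.ne']
  · intro t ht
    have hu : uu a b κ t = 0 := by
      rw [hdx] at ht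
      simpa [hκ.ne'] using ht
    have hin : t ∈ Ioo a b := by
      by_contra hout
      rw [uu_outside hout] at hu
      exact hκ.ne' hu
    refine ⟨zz_last a b ya r hr κ C hκ.ne' hC t hin hu (hreg t hu), ?_⟩
    rw [hdx, ((uu_hasDerivAt a b κ t).div_const κ).deriv]
    exact div_ne_zero (hreg t hu) hκ.ne'
  · intro i hi hir t
    obtain ⟨j, rfl⟩ := Nat.exists_eq_add_of_le' hi
    have h1 := hMb κ hκ hκ1 j (by omega) t
    have hpow : κ ^ (j + 1) ≤ κ := by
      rw [pow_succ]
      exact mul_le_of_le_one_left hκ.le (pow_le_one₀ hκ.le hκ1.le)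
    simp only [zz]
    rw [abs_mul, abs_mul, abs_of_pos (pow_pos hκ (j + 1))]
    calc κ ^ (j + 1) * |C| * _ ≤ κ * (|yb - ya| / m) * M := by gcongr
      _ = κ * (|yb - ya| / m * M) := by ring
      _ < ε := (lt_div_iff₀ (by positivity)).1 hκε
end

section
/- (Interpolation using zig-zags; Proposition 7.3 of del Pino–Toussaint, in standard coordinates on the unit ball.) Fix integers n ≥ 1, ℓ ≥ 1, r ≥ 1 and reals ε > 0 and δ ∈ (0,1). Let s_0, s_1 : ℝⁿ → ℝ^ℓ be smooth maps such that ‖iteratedFDeriv ℝ i s_0 x − iteratedFDeriv ℝ i s_1 x‖ < ε for every 0 ≤ i ≤ r and every x with 1−δ ≤ ‖x‖ ≤ 1. Then there exists an r-jet tuple (X, ζ_0,…,ζ_r) of smooth maps on ℝⁿ such that: (a) for ‖p‖ ≥ 1: X(p) = p and ζ_i(p) = iteratedFDeriv ℝ i s_0 p for all i; (b) for ‖p‖ ≤ 1−δ: X(p) = p and ζ_i(p) = iteratedFDeriv ℝ i s_1 p for all i; (c) the tuple is integral on ℝⁿ; (d) the set {p : fderiv ℝ X p is a linear isomorphism} is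 dense; (e) the front p ↦ (X p, ζ_0 p) is injective on the closed unit ball; (f) for every p in the closed unit ball, ‖X p − p‖ ≤ δ and ‖ζ_i p − iteratedFDeriv ℝ i s_1 (X p)‖ < 5ε for all 0 ≤ i ≤ r. -/
/- `ℝⁿ` in standard coordinates. -/
noncomputable section

abbrev Vec (n : ℕ) := Fin n → ℝ

/-- The ambient space of `Sym^i(ℝⁿ, ℝ^ℓ)`: continuous `i`-multilinear maps `(ℝⁿ)^i → ℝ^ℓ`. -/
abbrev SymMap (n ℓ i : ℕ) := ContinuousMultilinearMap ℝ (fun _ : Fin i => Vec n) (Vec ℓ)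

/-- A multilinear map is symmetric if it is invariant under permutations of its arguments. -/
def IsSymmMap {n ℓ i : ℕ} (A : SymMap n ℓ i) : Prop :=
  ∀ (e : Equiv.Perm (Fin i)) (v : Fin i → Vec n), A (v ∘ e) = A v

/-- The inclusion `ℤⁿ → ℝⁿ`. -/
def zcast {n : ℕ} (m : Fin n → ℤ) : Vec n := fun j => (m j : ℝ)

section zzparts

open Set Filter Topology
open scoped ContDiff


section part1
theorem zz_two_le : (2 : WithTop ℕ∞) ≤ ∞ := by
  change ((2 : ℕ∞) : WithTop ℕ∞) ≤ _
  exact WithTop.coe_le_coe.2 le_top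

variable {E F : Type*} [NormedAddCommGroup E] [NormedSpace ℝ E] [NormedAddCommGroup F]
  [NormedSpace ℝ F]

/-- directional derivative commutes with iterated derivatives -/
theorem zz_iter_dir {f : E → F} (hf : ContDiff ℝ ∞ f) (u : E) (i : ℕ) :
    ∀ (z : E) (m : Fin i → E), iteratedFDeriv ℝ i (fun z => fderiv ℝ f z u) z m =
      fderiv ℝ (iteratedFDeriv ℝ i f) z u m := by
  induction i with
  | zero =>
    intro z m
    have h : iteratedFDeriv ℝ 0 f =
      (continuousMultilinearCurryFin0 ℝ E F).symm ∘ f := iteratedFDeriv_zero_eq_comp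
    rw [h, iteratedFDeriv_zero_apply, LinearIsometryEquiv.comp_fderiv']
    rfl
  | succ i ih =>
    intro z m
    have hsm : ContDiff ℝ ∞ (iteratedFDeriv ℝ i f) := hf.iteratedFDeriv_right (m := ∞) (i := i) (by exact_mod_cast le_top)
    have h1 : iteratedFDeriv ℝ i (fun z => fderiv ℝ f z u) =
        fun z => fderiv ℝ (iteratedFDeriv ℝ i f) z u := by
      funext z; ext m; exact ih z m
    rw [iteratedFDeriv_succ_apply_left, h1]
    have hd : DifferentiableAt ℝ (fderiv ℝ (iteratedFDeriv ℝ i f)) z :=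
      ((hsm.fderiv_right (m := ∞) (by simp)).differentiable (by simp)) z
    have hs : IsSymmSndFDerivAt ℝ (iteratedFDeriv ℝ i f) z :=
      (hsm.contDiffAt).isSymmSndFDerivAt (by simpa using zz_two_le)
    have h2 : fderiv ℝ (fun z => fderiv ℝ (iteratedFDeriv ℝ i f) z u) z (m 0) =
        fderiv ℝ (fderiv ℝ (iteratedFDeriv ℝ i f)) z (m 0) u := by
      rw [fderiv_clm_apply hd (differentiableAt_const u)]
      simp
    rw [h2, hs.eq]
    have hsm1 : ContDiff ℝ ∞ (iteratedFDeriv ℝ (i+1) f) :=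
      hf.iteratedFDeriv_right (m := ∞) (i := i+1) (by exact_mod_cast le_top)
    rw [← fderiv_continuousMultilinear_apply_const_apply
      (hsm1.differentiable (by simp) z) m u]
    have h3 : (fun y => iteratedFDeriv ℝ (i+1) f y m) =
      fun y => (fderiv ℝ (iteratedFDeriv ℝ i f) y (m 0)) (Fin.tail m) := rfl
    rw [h3, fderiv_continuousMultilinear_apply_const_apply
      (hd.clm_apply (differentiableAt_const _)), fderiv_clm_apply hd (differentiableAt_const _)]
    simp

theorem zz_iter_cons {f : E → F} (hf : ContDiff ℝ ∞ f) (u : E) (i : ℕ) (z : E)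
    (m : Fin i → E) : iteratedFDeriv ℝ (i+1) f z (Fin.cons u m) =
      iteratedFDeriv ℝ i (fun z => fderiv ℝ f z u) z m := by
  rw [zz_iter_dir hf, iteratedFDeriv_succ_apply_left]
  simp

theorem zz_dir_smooth {f : E → F} (hf : ContDiff ℝ ∞ f) (u : E) :
    ContDiff ℝ ∞ (fun z => fderiv ℝ f z u) :=
  (hf.fderiv_right (m := ∞) (by simp)).clm_apply contDiff_const

theorem zz_symm {i : ℕ} : ∀ {f : E → F} (_ : ContDiff ℝ ∞ f) (σ : Equiv.Perm (Fin i)) (z : E)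
    (m : Fin i → E), iteratedFDeriv ℝ i f z (m ∘ σ) = iteratedFDeriv ℝ i f z m := by
  induction i with
  | zero =>
    intro f hf σ z m
    congr 1
    exact Subsingleton.elim _ _
  | succ i ih =>
    intro f hf σ z
    have key : σ ∈ Submonoid.closure
        (Set.range fun j : Fin i => Equiv.swap j.castSucc j.succ) := by
      rw [Equiv.Perm.mclosure_swap_castSucc_succ]; trivial
    induction key using Submonoid.closure_induction with
    | one => intro m; rfl
    | mul σ τ _ _ h1 h2 =>
      intro m
      have : m ∘ (σ * τ) = (m ∘ σ) ∘ τ := rfl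
      rw [this, h2, h1]
    | mem σ hσ =>
      obtain ⟨j, rfl⟩ := hσ
      intro m
      rcases i with _ | i
      · exact j.elim0
      refine Fin.cases ?_ (fun k => ?_) j
      · -- swap of the first two
        obtain ⟨a, m, rfl⟩ : ∃ a m', m = Fin.cons a m' := ⟨m 0, Fin.tail m, by simp⟩
        obtain ⟨b, m, rfl⟩ : ∃ a m', m = Fin.cons a m' := ⟨m 0, Fin.tail m, by simp⟩
        have : (Fin.cons a (Fin.cons b m) : Fin (i+1+1) → E) ∘
            (Equiv.swap (Fin.castSucc 0) (Fin.succ 0)) = Fin.cons b (Fin.cons a m) := by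
          funext k
          refine Fin.cases ?_ (fun k => ?_) k
          · simp
          · refine Fin.cases ?_ (fun k => ?_) k
            · simp
            · simp only [Function.comp]
              rw [Equiv.swap_apply_of_ne_of_ne]
              · simp
              · simp [Fin.ext_iff]
              · simp [Fin.ext_iff]
        rw [this, zz_iter_cons hf, zz_iter_cons (zz_dir_smooth hf _), zz_iter_cons hf,
          zz_iter_cons (zz_dir_smooth hf _)]
        congr 2
        funext y
        have hd : DifferentiableAt ℝ (fderiv ℝ f) y :=
          ((hf.fderiv_right (m := ∞) (by simp)).differentiable (by simp)) y
        have hs : IsSymmSndFDerivAt ℝ f y := (hf.contDiffAt).isSymmSndFDerivAt (by simpa using zz_two_le)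
        rw [fderiv_clm_apply hd (differentiableAt_const _),
          fderiv_clm_apply hd (differentiableAt_const _)]
        simpa using hs.eq a b
      · obtain ⟨a, m, rfl⟩ : ∃ a m', m = Fin.cons a m' := ⟨m 0, Fin.tail m, by simp⟩
        have : (Fin.cons a m : Fin (i+1+1) → E) ∘
            (Equiv.swap (Fin.castSucc k.succ) (Fin.succ k.succ)) =
            Fin.cons a (m ∘ Equiv.swap k.castSucc k.succ) := by
          funext l
          refine Fin.cases ?_ (fun l => ?_) l
          · simp only [Function.comp]
            rw [Equiv.swap_apply_of_ne_of_ne]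
            · simp
            · simp [Fin.ext_iff]
            · simp [Fin.ext_iff]
          · simp only [Function.comp, Fin.cons_succ]
            rw [← Fin.succ_castSucc, ← Function.Injective.map_swap (Fin.succ_injective _)]
            simp
        rw [this, zz_iter_cons hf, zz_iter_cons hf]
        exact ih (zz_dir_smooth hf a) _ _ _

/-- vanishing of jets along the zero set of a high power -/
theorem zz_vanish {E : Type} [NormedAddCommGroup E] [NormedSpace ℝ E] {ψ : E → ℝ} (hψ : ContDiff ℝ ∞ ψ) {z : E} (hz : ψ z = 0) (i : ℕ) :
    ∀ {G : Type} [NormedAddCommGroup G] [NormedSpace ℝ G] {κ : E → G} (_ : ContDiff ℝ ∞ κ)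
    (m : ℕ) (_ : i < m), iteratedFDeriv ℝ i (fun x => ψ x ^ m • κ x) z = 0 := by
  induction i with
  | zero =>
    intro G _ _ κ hκ m hm
    ext v
    simp [hz, hm.ne']
  | succ i ih =>
    intro G _ _ κ hκ m hm
    obtain ⟨m, rfl⟩ : ∃ m', m = m' + 1 := ⟨m - 1, by omega⟩
    have h : fderiv ℝ (fun x => ψ x ^ (m+1) • κ x) = fun x => ψ x ^ m •
        (ψ x • fderiv ℝ κ x + ((m+1 : ℝ) • fderiv ℝ ψ x).smulRight (κ x)) := by
      funext x
      have h1 := (hψ.differentiable (by simp) x).hasFDerivAt.pow (m+1)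
      have h2 := (hκ.differentiable (by simp) x).hasFDerivAt
      have h3 := (h1.smul h2).fderiv
      change fderiv ℝ (fun x => ψ x ^ (m+1) • κ x) x = _ at h3
      rw [h3]
      ext v
      simp [smul_smul, pow_succ]
      congr 1
      ring
    rw [← norm_eq_zero, ← norm_iteratedFDeriv_fderiv, norm_eq_zero, h]
    refine ih ?_ m (by omega)
    have a1 := hκ.fderiv_right (m := ∞) (by simp)
    have a2 := hψ.fderiv_right (m := ∞) (by simp)
    fun_prop

end part1


section part2

theorem zz_partial {E T F : Type*} [NormedAddCommGroup E] [NormedSpace ℝ E]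
    [NormedAddCommGroup T] [NormedSpace ℝ T] [NormedAddCommGroup F] [NormedSpace ℝ F]
    {Φ : E × T → F} (hΦ : ContDiff ℝ ∞ Φ) (i : ℕ) (x : E) (t : T) :
    iteratedFDeriv ℝ i (fun x => Φ (x, t)) x =
      (iteratedFDeriv ℝ i Φ (x, t)).compContinuousLinearMap
        (fun _ => ContinuousLinearMap.inl ℝ E T) := by
  have h1 : (fun x => Φ (x, t)) =
      (fun z => Φ (z + ((0 : E), t))) ∘ (ContinuousLinearMap.inl ℝ E T) := by
    funext x; simp
  rw [h1, ContinuousLinearMap.iteratedFDeriv_comp_right (n := ∞) _ (by fun_prop) x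
    (by exact_mod_cast le_top), iteratedFDeriv_comp_add_right]
  simp

theorem zz_partial_smooth {E T F P : Type*} [NormedAddCommGroup E] [NormedSpace ℝ E]
    [NormedAddCommGroup T] [NormedSpace ℝ T] [NormedAddCommGroup F] [NormedSpace ℝ F]
    [NormedAddCommGroup P] [NormedSpace ℝ P]
    {Φ : E × T → F} (hΦ : ContDiff ℝ ∞ Φ) (i : ℕ) {X : P → E} {q : P → T}
    (hX : ContDiff ℝ ∞ X) (hq : ContDiff ℝ ∞ q) :
    ContDiff ℝ ∞ (fun p => iteratedFDeriv ℝ i (fun x => Φ (x, q p)) (X p)) := by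
  simp_rw [zz_partial hΦ]
  have h : ContDiff ℝ ∞ (iteratedFDeriv ℝ i Φ) :=
    hΦ.iteratedFDeriv_right (m := ∞) (i := i) (by exact_mod_cast le_top)
  exact (ContinuousMultilinearMap.compContinuousLinearMapL
    (fun _ : Fin i => ContinuousLinearMap.inl ℝ E T)).contDiff.comp (h.comp (hX.prodMk hq))

theorem zz_bounded {E T F : Type*} [NormedAddCommGroup E] [NormedSpace ℝ E]
    [NormedAddCommGroup T] [NormedSpace ℝ T] [NormedAddCommGroup F] [NormedSpace ℝ F]
    {Φ : E × T → F} (hΦ : ContDiff ℝ ∞ Φ) (r : ℕ) {S : Set E} {U : Set T}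
    (hS : IsCompact S) (hU : IsCompact U) :
    ∃ C : ℝ, 0 ≤ C ∧ ∀ i ≤ r, ∀ x ∈ S, ∀ t ∈ U,
      ‖iteratedFDeriv ℝ i (fun x => Φ (x, t)) x‖ ≤ C := by
  have h : ∀ i : ℕ, ∃ C : ℝ, 0 ≤ C ∧ ∀ x ∈ S, ∀ t ∈ U,
      ‖iteratedFDeriv ℝ i (fun x => Φ (x, t)) x‖ ≤ C := by
    intro i
    have hc := (zz_partial_smooth hΦ i (contDiff_fst (𝕜 := ℝ) (E := E) (F := T))
      contDiff_snd).continuous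
    obtain ⟨C, hC⟩ := (hS.prod hU).exists_bound_of_continuousOn hc.continuousOn
    exact ⟨max C 0, le_max_right _ _, fun x hx t ht => (hC (x, t) ⟨hx, ht⟩).trans (le_max_left _ _)⟩
  choose C hC0 hC using h
  refine ⟨∑ i ∈ Finset.range (r+1), C i, Finset.sum_nonneg fun i _ => hC0 i, ?_⟩
  intro i hi x hx t ht
  exact (hC i x hx t ht).trans
    (Finset.single_le_sum (fun i _ => hC0 i) (Finset.mem_range.2 (by omega)))

theorem zz_integral {E F P : Type} [NormedAddCommGroup E] [NormedSpace ℝ E]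
    [NormedAddCommGroup F] [NormedSpace ℝ F]
    [NormedAddCommGroup P] [NormedSpace ℝ P]
    {Φ : E × ℝ → F} (hΦ : ContDiff ℝ ∞ Φ) {X : P → E} {q : P → ℝ}
    (hX : ContDiff ℝ ∞ X) (hq : ContDiff ℝ ∞ q)
    {ψ : E × ℝ → ℝ} (hψ : ContDiff ℝ ∞ ψ) {κ : E × ℝ → F} (hκ : ContDiff ℝ ∞ κ) {m : ℕ}
    (hd : ∀ z, fderiv ℝ Φ z (0, 1) = ψ z ^ m • κ z) (h0 : ∀ p, ψ (X p, q p) = 0)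
    (i : ℕ) (hi : i < m) (p v : P) (w : Fin i → E) :
    (fderiv ℝ (fun p => iteratedFDeriv ℝ i (fun x => Φ (x, q p)) (X p)) p v) w =
      iteratedFDeriv ℝ (i+1) (fun x => Φ (x, q p)) (X p) (Fin.cons (fderiv ℝ X p v) w) := by
  have hsm := (zz_partial_smooth hΦ i hX hq).differentiable (by simp) p
  rw [← fderiv_continuousMultilinear_apply_const_apply hsm]
  simp_rw [zz_partial hΦ]
  simp only [ContinuousMultilinearMap.compContinuousLinearMap_apply]
  have h : ContDiff ℝ ∞ (iteratedFDeriv ℝ i Φ) :=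
    hΦ.iteratedFDeriv_right (m := ∞) (i := i) (by exact_mod_cast le_top)
  have hX' := (hX.differentiable (by simp) p).hasFDerivAt
  have hq' := (hq.differentiable (by simp) p).hasFDerivAt
  have hc := (h.differentiable (by simp) (X p, q p)).hasFDerivAt.comp p (hX'.prodMk hq')
  have e1 := fderiv_continuousMultilinear_apply_const_apply hc.differentiableAt
    (fun j => ContinuousLinearMap.inl ℝ E ℝ (w j)) v
  rw [hc.fderiv] at e1
  refine Eq.trans e1 ?_
  have e2 : (fun j => ContinuousLinearMap.inl ℝ E ℝ
      ((Fin.cons (fderiv ℝ X p v) w : Fin (i+1) → E) j)) =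
      Fin.cons (fderiv ℝ X p v, (0:ℝ)) (fun j => ContinuousLinearMap.inl ℝ E ℝ (w j)) := by
    funext j
    refine Fin.cases ?_ (fun j => ?_) j <;> simp
  rw [e2, iteratedFDeriv_succ_apply_left]
  simp only [Fin.cons_zero, Fin.tail_cons, ContinuousLinearMap.comp_apply,
    ContinuousLinearMap.prod_apply]
  have e3 : ((fderiv ℝ X p v, fderiv ℝ q p v) : E × ℝ) =
      (fderiv ℝ X p v, 0) + (fderiv ℝ q p v) • ((0 : E), (1:ℝ)) := by simp
  rw [e3, map_add, map_smul]
  have e4 : fderiv ℝ (iteratedFDeriv ℝ i Φ) (X p, q p) ((0 : E), (1:ℝ)) = 0 := by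
    ext m'
    rw [← zz_iter_dir hΦ]
    have : (fun z => fderiv ℝ Φ z ((0 : E), (1:ℝ))) = fun z => ψ z ^ m • κ z := funext hd
    rw [this, zz_vanish hψ (h0 p) i hκ m hi]
  rw [e4]
  simp

end part2


section part3

/-- the basic bump supported in `[0,1]` -/
def zB (s : ℝ) : ℝ := expNegInvGlue s * expNegInvGlue (1 - s)

theorem zB_smooth : ContDiff ℝ ∞ zB := by
  unfold zB
  have h : ContDiff ℝ ∞ expNegInvGlue := expNegInvGlue.contDiff
  exact h.mul (h.comp (by fun_prop))

theorem zB_cont : Continuous zB := zB_smooth.continuous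

theorem zB_nonneg (s : ℝ) : 0 ≤ zB s :=
  mul_nonneg (expNegInvGlue.nonneg _) (expNegInvGlue.nonneg _)

theorem zB_pos {s : ℝ} (h0 : 0 < s) (h1 : s < 1) : 0 < zB s :=
  mul_pos (expNegInvGlue.pos_of_pos h0) (expNegInvGlue.pos_of_pos (by linarith))

theorem zB_of_nonpos {s : ℝ} (h0 : s ≤ 0) : zB s = 0 := by
  simp [zB, expNegInvGlue.zero_of_nonpos h0]

theorem zB_of_one_le {s : ℝ} (h0 : 1 ≤ s) : zB s = 0 := by
  simp [zB, expNegInvGlue.zero_of_nonpos (sub_nonpos.2 h0)]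

theorem zE_le_one (s : ℝ) : expNegInvGlue s ≤ 1 := by
  unfold expNegInvGlue
  split_ifs with h
  · exact zero_le_one
  · push Not at h
    rw [Real.exp_le_one_iff]
    have := inv_pos.2 h
    linarith

theorem zB_le_one (s : ℝ) : zB s ≤ 1 :=
  mul_le_one₀ (zE_le_one _) (expNegInvGlue.nonneg _) (zE_le_one _)

theorem zB_symm (s : ℝ) : zB (1 - s) = zB s := by
  simp [zB, mul_comm]

theorem zB_quarter : zB (1/4) < zB (1/2) := by
  unfold zB expNegInvGlue
  norm_num
  rw [← Real.exp_add, ← Real.exp_add, Real.exp_lt_exp]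
  norm_num

def zN (m : ℕ) (Δ y s t h : ℝ) : ℝ := ∫ u in (0:ℝ)..s, zB u * (y - t - h * u - Δ * zB u) ^ m

def zG (m : ℕ) (Δ y s t h : ℝ) : ℝ := zN m Δ y s t h / zN m Δ y 1 t h

theorem zN_integrand_cont (m : ℕ) (Δ y t h : ℝ) :
    Continuous fun u => zB u * (y - t - h * u - Δ * zB u) ^ m := by
  have := zB_cont
  fun_prop

theorem zN_hasDeriv (m : ℕ) (Δ y s t h : ℝ) :
    HasDerivAt (fun s => zN m Δ y s t h) (zB s * (y - t - h * s - Δ * zB s) ^ m) s := by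
  exact intervalIntegral.integral_hasDerivAt_right
    ((zN_integrand_cont m Δ y t h).intervalIntegrable _ _)
    ((zN_integrand_cont m Δ y t h).stronglyMeasurableAtFilter _ _)
    (zN_integrand_cont m Δ y t h).continuousAt

theorem zPrim_smooth {f : ℝ → ℝ} (hf : ContDiff ℝ ∞ f) :
    ContDiff ℝ ∞ (fun s => ∫ u in (0:ℝ)..s, f u) := by
  have hd : ∀ s, HasDerivAt (fun s => ∫ u in (0:ℝ)..s, f u) (f s) s := fun s =>
    intervalIntegral.integral_hasDerivAt_right (hf.continuous.intervalIntegrable _ _)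
      (hf.continuous.stronglyMeasurableAtFilter _ _) hf.continuous.continuousAt
  rw [contDiff_infty_iff_deriv]
  refine ⟨fun s => (hd s).differentiableAt, ?_⟩
  have : deriv (fun s => ∫ u in (0:ℝ)..s, f u) = f := funext fun s => (hd s).deriv
  rwa [this]

theorem zN_smooth (m : ℕ) (Δ : ℝ) :
    ContDiff ℝ ∞ (fun z : ℝ × ℝ × ℝ × ℝ => zN m Δ z.1 z.2.1 z.2.2.1 z.2.2.2) := by
  have e : (fun z : ℝ × ℝ × ℝ × ℝ => zN m Δ z.1 z.2.1 z.2.2.1 z.2.2.2) =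
      fun z => ∑ k ∈ Finset.range (m+1), ∑ l ∈ Finset.range (m-k+1),
        ((z.1 - z.2.2.1) ^ k * (- z.2.2.2) ^ l * ((m-k).choose l) * (m.choose k)) *
        ∫ u in (0:ℝ)..z.2.1, zB u * u ^ l * (- Δ * zB u) ^ (m-k-l) := by
    funext z
    unfold zN
    simp_rw [← intervalIntegral.integral_const_mul]
    have hc : ∀ k l : ℕ, IntervalIntegrable (fun u => ((z.1 - z.2.2.1) ^ k * (- z.2.2.2) ^ l *
        ((m-k).choose l) * (m.choose k)) * (zB u * u ^ l * (- Δ * zB u) ^ (m-k-l)))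
        MeasureTheory.volume 0 z.2.1 := by
      intro k l
      apply Continuous.intervalIntegrable
      have := zB_cont
      fun_prop
    rw [Finset.sum_congr rfl fun k _ =>
      (intervalIntegral.integral_finsetSum (s := Finset.range (m-k+1))
        (fun l _ => hc k l)).symm]
    rw [← intervalIntegral.integral_finsetSum]
    · congr 1
      funext u
      have : z.1 - z.2.2.1 - z.2.2.2 * u - Δ * zB u =
        (z.1 - z.2.2.1) + ((- z.2.2.2 * u) + (-Δ * zB u)) := by ring
      rw [this, add_pow, Finset.mul_sum]
      refine Finset.sum_congr rfl fun k _ => ?_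
      rw [add_pow, Finset.mul_sum, Finset.sum_mul, Finset.mul_sum]
      refine Finset.sum_congr rfl fun l _ => ?_
      rw [mul_pow (- z.2.2.2) u]
      ring
    · intro k _
      apply Continuous.intervalIntegrable
      have := zB_cont
      fun_prop
  rw [e]
  refine ContDiff.sum fun k _ => ContDiff.sum fun l _ => ContDiff.mul ?_ ?_
  · fun_prop
  · have hB := zB_smooth
    exact (zPrim_smooth (f := fun u => zB u * u ^ l * (- Δ * zB u) ^ (m-k-l))
      (by fun_prop)).comp (contDiff_fst.comp contDiff_snd)

theorem zN_nonneg_integrand {m : ℕ} (hm : Even m) (Δ y t h u : ℝ) :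
    0 ≤ zB u * (y - t - h * u - Δ * zB u) ^ m := mul_nonneg (zB_nonneg _) (hm.pow_nonneg _)

theorem zN_one_pos {m : ℕ} (hm : Even m) {Δ : ℝ} (hΔ : Δ ≠ 0) (y t h : ℝ) :
    0 < zN m Δ y 1 t h := by
  apply intervalIntegral.integral_pos one_pos (zN_integrand_cont m Δ y t h).continuousOn
    (fun u _ => zN_nonneg_integrand hm Δ y t h u)
  by_contra hcon
  push Not at hcon
  have key : ∀ c : ℝ, 0 < c → c < 1 → y - t - h * c - Δ * zB c = 0 := by
    intro c h0 h1
    by_contra hne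
    exact absurd (hcon c ⟨h0.le, h1.le⟩) (not_le.2 (mul_pos (zB_pos h0 h1) (hm.pow_pos hne)))
  have k1 := key (1/4) (by norm_num) (by norm_num)
  have k2 := key (1/2) (by norm_num) (by norm_num)
  have k3 := key (1 - 1/4) (by norm_num) (by norm_num)
  rw [zB_symm] at k3
  have hh : h = 0 := by linarith
  subst hh
  have : Δ * (zB (1/2) - zB (1/4)) = 0 := by linarith
  rcases mul_eq_zero.1 this with h | h
  · exact hΔ h
  · linarith [zB_quarter]

theorem zG_smooth {m : ℕ} (hm : Even m) {Δ : ℝ} (hΔ : Δ ≠ 0) :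
    ContDiff ℝ ∞ (fun z : ℝ × ℝ × ℝ × ℝ => zG m Δ z.1 z.2.1 z.2.2.1 z.2.2.2) := by
  have h := zN_smooth m Δ
  refine ContDiff.div h ?_ (fun z => (zN_one_pos hm hΔ _ _ _).ne')
  exact h.comp (g := fun z : ℝ × ℝ × ℝ × ℝ => zN m Δ z.1 z.2.1 z.2.2.1 z.2.2.2)
    (f := fun z : ℝ × ℝ × ℝ × ℝ => (z.1, (1:ℝ), z.2.2.1, z.2.2.2)) (by fun_prop)

theorem zG_hasDeriv (m : ℕ) (Δ y s t h : ℝ) :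
    HasDerivAt (fun s => zG m Δ y s t h)
      (zB s * (y - t - h * s - Δ * zB s) ^ m / zN m Δ y 1 t h) s :=
  (zN_hasDeriv m Δ y s t h).div_const _

theorem zG_of_nonpos {m : ℕ} {Δ y s t h : ℝ} (hs : s ≤ 0) : zG m Δ y s t h = 0 := by
  have : zN m Δ y s t h = 0 := by
    unfold zN
    rw [intervalIntegral.integral_congr (g := fun _ => 0)]
    · simp
    · intro u hu
      rw [uIcc_of_ge hs] at hu
      simp [zB_of_nonpos hu.2]
  simp [zG, this]

theorem zG_of_one_le {m : ℕ} (hm : Even m) {Δ : ℝ} (hΔ : Δ ≠ 0) {y s t h : ℝ} (hs : 1 ≤ s) :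
    zG m Δ y s t h = 1 := by
  have : zN m Δ y s t h = zN m Δ y 1 t h := by
    unfold zN
    rw [← intervalIntegral.integral_add_adjacent_intervals
      ((zN_integrand_cont m Δ y t h).intervalIntegrable 0 1)
      ((zN_integrand_cont m Δ y t h).intervalIntegrable 1 s)]
    rw [intervalIntegral.integral_congr (a := 1) (b := s) (g := fun _ => 0)]
    · simp
    · intro u hu
      rw [uIcc_of_le hs] at hu
      simp [zB_of_one_le hu.1]
  rw [zG, this, div_self (zN_one_pos hm hΔ _ _ _).ne']

end part3


section part4

theorem zz_bad_countable (f : ℝ → ℝ) : {c | (interior {u | f u = c}).Nonempty}.Countable := by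
  apply Set.PairwiseDisjoint.countable_of_isOpen (s := fun c => interior {u | f u = c})
  · intro c _ c' _ hne
    refine Set.disjoint_left.2 fun u hu hu' => hne ?_
    have h1 : u ∈ {u | f u = c} := interior_subset hu
    have h2 : u ∈ {u | f u = c'} := interior_subset hu'
    exact Eq.trans (Eq.symm h1) h2
  · intro c _; exact isOpen_interior
  · intro c hc; exact hc

theorem zz_floor (u : ℝ) {K : ℕ} (hK : 1 ≤ K) : ∃ j < K, ∀ i < K, i ≠ j →
    (i < j ∧ 1 ≤ u - i) ∨ (j < i ∧ u - i ≤ 0) := by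
  refine ⟨min ⌊u⌋₊ (K-1), by omega, fun i hi hne => ?_⟩
  rcases lt_or_gt_of_ne hne with h | h
  · left
    refine ⟨h, ?_⟩
    have h1 : i + 1 ≤ ⌊u⌋₊ := by omega
    have h2 := (Nat.le_floor_iff' (by omega)).1 h1
    push_cast at h2
    linarith
  · right
    refine ⟨h, ?_⟩
    have h1 : ⌊u⌋₊ < i := by omega
    have := (Nat.floor_lt' (by omega)).1 h1
    linarith

/-- the periodised bump -/
def zP (K : ℕ) (u : ℝ) : ℝ := ∑ j ∈ Finset.range K, zB (u - j)

theorem zP_smooth (K : ℕ) : ContDiff ℝ ∞ (zP K) := by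
  unfold zP
  refine ContDiff.sum fun j _ => ?_
  exact zB_smooth.comp (by fun_prop)

theorem zP_eq {K : ℕ} {u : ℝ} {j : ℕ} (hj : j < K) (h : zB (u - j) ≠ 0) :
    zP K u = zB (u - j) := by
  unfold zP
  refine Finset.sum_eq_single j (fun i _ hne => ?_) (fun h => absurd (Finset.mem_range.2 hj) h)
  have h0 : 0 < u - j := by
    by_contra hc; exact h (zB_of_nonpos (not_lt.1 hc))
  have h1 : u - j < 1 := by
    by_contra hc; exact h (zB_of_one_le (not_lt.1 hc))
  rcases lt_or_gt_of_ne hne with hl | hl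
  · apply zB_of_one_le
    have : (i:ℝ) + 1 ≤ j := by exact_mod_cast hl
    linarith
  · apply zB_of_nonpos
    have : (j:ℝ) + 1 ≤ i := by exact_mod_cast hl
    linarith

theorem zP_nonneg (K : ℕ) (u : ℝ) : 0 ≤ zP K u := Finset.sum_nonneg fun _ _ => zB_nonneg _

theorem zP_le_one (K : ℕ) (u : ℝ) : zP K u ≤ 1 := by
  by_cases h : ∃ j < K, zB (u - j) ≠ 0
  · obtain ⟨j, hj, h⟩ := h
    rw [zP_eq hj h]; exact zB_le_one _
  · push Not at h
    unfold zP
    rw [Finset.sum_eq_zero fun j hj => h j (Finset.mem_range.1 hj)]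
    exact zero_le_one

theorem zP_of_nonpos {K : ℕ} {u : ℝ} (hu : u ≤ 0) : zP K u = 0 :=
  Finset.sum_eq_zero fun j _ => zB_of_nonpos (by
    have : (0:ℝ) ≤ j := Nat.cast_nonneg _
    linarith)

theorem zP_of_ge {K : ℕ} {u : ℝ} (hu : (K:ℝ) ≤ u) : zP K u = 0 :=
  Finset.sum_eq_zero fun j hj => zB_of_one_le (by
    have : (j:ℝ) + 1 ≤ K := by exact_mod_cast (Finset.mem_range.1 hj)
    linarith)

theorem zz_choose_amp {L : ℝ} (hL : 0 < L) : ∃ Δ : ℝ, 0 < Δ ∧ Δ < L ∧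
    ∀ K : ℕ, 1 ≤ K → interior {u | deriv (zP K) u = - (L / K) / Δ} = ∅ := by
  have hc : (⋃ K : ℕ, (fun c => - (L / K) / c) ''
      {c | (interior {u | deriv (zP K) u = c}).Nonempty}).Countable :=
    Set.countable_iUnion fun K => (zz_bad_countable _).image _
  obtain ⟨Δ, hΔ, h1⟩ := (hc.dense_compl ℝ).exists_between hL
  refine ⟨Δ, h1.1, h1.2, fun K hK => ?_⟩
  by_contra hne
  apply hΔ
  refine mem_iUnion.2 ⟨K, - (L/K)/Δ, Set.nonempty_iff_ne_empty.2 hne, ?_⟩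
  have hK' : (0:ℝ) < K := by exact_mod_cast hK
  have := h1.1
  simp only
  field_simp

/-- strict monotonicity from a derivative vanishing on a small set -/
theorem zz_strict {A φ k : ℝ → ℝ} {y : ℝ} {m : ℕ} (hm : Even m)
    (hA : ∀ τ, HasDerivAt A ((y - φ τ) ^ m * k τ) τ) (hk0 : ∀ τ, 0 ≤ k τ)
    (hkc : Continuous k) (hφ : Dense {τ | deriv φ τ ≠ 0})
    {a b : ℝ} (hk : ∀ c d, a ≤ c → c < d → d ≤ b → ∃ σ ∈ Ioo c d, 0 < k σ)
    {c d : ℝ} (hc : a ≤ c) (hcd : c < d) (hd : d ≤ b) : A c < A d := by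
  have hmono : Monotone A := by
    apply monotone_of_deriv_nonneg (fun τ => (hA τ).differentiableAt)
    intro τ
    rw [(hA τ).deriv]
    exact mul_nonneg (hm.pow_nonneg _) (hk0 _)
  refine lt_of_le_of_ne (hmono hcd.le) fun heq => ?_
  obtain ⟨σ, hσ, hkσ⟩ := hk c d hc hcd hd
  have hconst : ∀ τ ∈ Ioo c d, A τ = A c := fun τ hτ =>
    le_antisymm ((hmono hτ.2.le).trans heq.ge) (hmono hτ.1.le)
  have hU : IsOpen (Ioo c d ∩ {τ | 0 < k τ}) :=
    isOpen_Ioo.inter (isOpen_lt continuous_const hkc)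
  have hzero : ∀ τ ∈ Ioo c d ∩ {τ | 0 < k τ}, φ τ = y := by
    intro τ hτ
    have h1 : A =ᶠ[𝓝 τ] fun _ => A c := by
      filter_upwards [isOpen_Ioo.mem_nhds hτ.1] with t ht using hconst t ht
    have h2 : (y - φ τ) ^ m * k τ = 0 :=
      (hA τ).unique ((hasDerivAt_const τ (A c)).congr_of_eventuallyEq h1)
    rcases mul_eq_zero.1 h2 with h | h
    · have h3 := eq_zero_of_pow_eq_zero h
      linarith
    · exact absurd h (ne_of_gt hτ.2)
  obtain ⟨τ, hτU, hτ⟩ := hφ.inter_open_nonempty _ hU ⟨σ, hσ, hkσ⟩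
  apply hτ
  have h1 : φ =ᶠ[𝓝 τ] fun _ => y := by
    filter_upwards [hU.mem_nhds hτU] with t ht using hzero t ht
  rw [h1.deriv_eq]; simp

end part4


section part5

def zphi (Δ a h : ℝ) (K : ℕ) (τ : ℝ) : ℝ := τ + Δ * zP K ((τ - a) / h)

def zA (m : ℕ) (Δ a h : ℝ) (K : ℕ) (y τ : ℝ) : ℝ :=
  (1 / (K : ℝ)) * ∑ j ∈ Finset.range K, zG m Δ y ((τ - a) / h - j) (a + j * h) h

def zk (m : ℕ) (Δ a h : ℝ) (K : ℕ) (y τ : ℝ) : ℝ :=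
  (1 / (K * h)) * ∑ j ∈ Finset.range K, zB ((τ - a) / h - j) / zN m Δ y 1 (a + j * h) h

theorem zphi_smooth (Δ a h : ℝ) (K : ℕ) : ContDiff ℝ ∞ (zphi Δ a h K) := by
  unfold zphi
  exact contDiff_id.add (contDiff_const.mul ((zP_smooth K).comp (by fun_prop)))

theorem zA_smooth {m : ℕ} (hm : Even m) {Δ : ℝ} (hΔ : Δ ≠ 0) (a h : ℝ) (K : ℕ) :
    ContDiff ℝ ∞ (fun z : ℝ × ℝ => zA m Δ a h K z.1 z.2) := by
  unfold zA
  refine contDiff_const.mul (ContDiff.sum fun j _ => ?_)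
  exact (zG_smooth hm hΔ).comp
    (f := fun z : ℝ × ℝ => (z.1, (z.2 - a) / h - j, a + j * h, h)) (by fun_prop)

theorem zk_smooth {m : ℕ} (hm : Even m) {Δ : ℝ} (hΔ : Δ ≠ 0) (a h : ℝ) (K : ℕ) :
    ContDiff ℝ ∞ (fun z : ℝ × ℝ => zk m Δ a h K z.1 z.2) := by
  unfold zk
  refine contDiff_const.mul (ContDiff.sum fun j _ => ?_)
  refine ContDiff.div (zB_smooth.comp (by fun_prop)) ?_ (fun z => (zN_one_pos hm hΔ _ _ _).ne')
  exact (zN_smooth m Δ).comp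
    (f := fun z : ℝ × ℝ => (z.1, (1:ℝ), a + j * h, h)) (by fun_prop)

theorem zk_nonneg {m : ℕ} (hm : Even m) {Δ : ℝ} (hΔ : Δ ≠ 0) (a : ℝ) {h : ℝ} (hh : 0 < h) (K : ℕ)
    (y τ : ℝ) : 0 ≤ zk m Δ a h K y τ := by
  unfold zk
  refine mul_nonneg (by positivity) (Finset.sum_nonneg fun j _ => ?_)
  exact div_nonneg (zB_nonneg _) (zN_one_pos hm hΔ _ _ _).le

theorem zA_hasDeriv (m : ℕ) (Δ a : ℝ) {h : ℝ} (hh : 0 < h) (K : ℕ) (y τ : ℝ) :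
    HasDerivAt (zA m Δ a h K y) ((y - zphi Δ a h K τ) ^ m * zk m Δ a h K y τ) τ := by
  have h1 : HasDerivAt (zA m Δ a h K y) ((1 / (K:ℝ)) * ∑ j ∈ Finset.range K,
      (zB ((τ - a) / h - j) * (y - (a + j * h) - h * ((τ - a) / h - j) -
        Δ * zB ((τ - a) / h - j)) ^ m / zN m Δ y 1 (a + j * h) h) * (1 / h)) τ := by
    unfold zA
    refine HasDerivAt.const_mul _ (HasDerivAt.fun_sum fun j _ => ?_)
    have h2 : HasDerivAt (fun τ : ℝ => (τ - a) / h - j) (1 / h) τ :=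
      (((hasDerivAt_id τ).sub_const a).div_const h).sub_const _
    exact HasDerivAt.comp (h := fun τ : ℝ => (τ - a) / h - j) τ
      (zG_hasDeriv m Δ y ((τ - a) / h - j) (a + j * h) h) h2
  convert h1 using 1
  unfold zk
  rw [mul_left_comm, Finset.mul_sum, Finset.mul_sum, Finset.mul_sum]
  refine Finset.sum_congr rfl fun j hj => ?_
  by_cases hb : zB ((τ - a) / h - j) = 0
  · simp [hb]
  · have e : y - (a + j * h) - h * ((τ - a) / h - j) - Δ * zB ((τ - a) / h - j) =
        y - zphi Δ a h K τ := by
      unfold zphi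
      rw [zP_eq (Finset.mem_range.1 hj) hb]
      field_simp
      ring
    rw [e]
    field_simp

theorem zphi_deriv (Δ a h : ℝ) (K : ℕ) (τ : ℝ) :
    deriv (zphi Δ a h K) τ = 1 + Δ * (deriv (zP K) ((τ - a) / h) * (1 / h)) := by
  have h1 : HasDerivAt (zP K) (deriv (zP K) ((τ - a) / h)) ((τ - a) / h) :=
    ((zP_smooth K).differentiable (by simp) _).hasDerivAt
  have h2 := h1.comp τ (((hasDerivAt_id τ).sub_const a).div_const h)
  exact ((hasDerivAt_id τ).add (h2.const_mul Δ)).deriv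

theorem zphi_dense {Δ a h : ℝ} (hΔ : 0 < Δ) (hh : 0 < h) {K : ℕ}
    (hz : interior {u | deriv (zP K) u = - h / Δ} = ∅) :
    Dense {τ | deriv (zphi Δ a h K) τ ≠ 0} := by
  have e : {τ | deriv (zphi Δ a h K) τ ≠ 0} = {τ | deriv (zphi Δ a h K) τ = 0}ᶜ := rfl
  rw [e, ← interior_eq_empty_iff_dense_compl]
  by_contra hne
  obtain ⟨τ, hτ⟩ := Set.nonempty_iff_ne_empty.2 hne
  have hc : Continuous (fun u : ℝ => a + h * u) := by fun_prop
  have hsub : (fun u : ℝ => a + h * u) ⁻¹' interior {τ | deriv (zphi Δ a h K) τ = 0} ⊆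
      interior {u | deriv (zP K) u = - h / Δ} := by
    apply interior_maximal _ (isOpen_interior.preimage hc)
    intro u hu
    have h1 : a + h * u ∈ {τ | deriv (zphi Δ a h K) τ = 0} := interior_subset hu
    simp only [mem_ofPred_eq] at h1 ⊢
    rw [zphi_deriv] at h1
    have e2 : (a + h * u - a) / h = u := by field_simp; ring
    rw [e2] at h1
    field_simp at h1 ⊢
    linarith
  have h3 : (τ - a) / h ∈ (fun u : ℝ => a + h * u) ⁻¹' interior {τ | deriv (zphi Δ a h K) τ = 0} := by
    have : a + h * ((τ - a) / h) = τ := by field_simp; ring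
    simp only [mem_preimage, this]
    exact hτ
  have := hsub h3
  rw [hz] at this
  exact this

theorem zA_of_le {m : ℕ} {Δ a h : ℝ} (hh : 0 < h) {K : ℕ} {y τ : ℝ} (hτ : τ ≤ a) :
    zA m Δ a h K y τ = 0 := by
  unfold zA
  rw [Finset.sum_eq_zero, mul_zero]
  intro j _
  apply zG_of_nonpos
  have : (τ - a) / h ≤ 0 := div_nonpos_of_nonpos_of_nonneg (by linarith) hh.le
  have : (0:ℝ) ≤ j := Nat.cast_nonneg _
  linarith

theorem zA_of_ge {m : ℕ} (hm : Even m) {Δ : ℝ} (hΔ : Δ ≠ 0) {a h : ℝ} (hh : 0 < h) {K : ℕ}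
    (hK : 1 ≤ K) {y τ : ℝ} (hτ : a + K * h ≤ τ) : zA m Δ a h K y τ = 1 := by
  unfold zA
  have hK' : (0:ℝ) < K := by exact_mod_cast hK
  rw [Finset.sum_congr rfl (g := fun _ => (1:ℝ))]
  · simp; field_simp
  intro j hj
  apply zG_of_one_le hm hΔ
  have : (K:ℝ) ≤ (τ - a) / h := by rw [le_div_iff₀ hh]; linarith
  have : (j:ℝ) + 1 ≤ K := by exact_mod_cast (Finset.mem_range.1 hj)
  linarith

theorem zk_of_le {m : ℕ} {Δ a h : ℝ} (hh : 0 < h) {K : ℕ} {y τ : ℝ} (hτ : τ ≤ a) :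
    zk m Δ a h K y τ = 0 := by
  unfold zk
  rw [Finset.sum_eq_zero, mul_zero]
  intro j _
  rw [zB_of_nonpos, zero_div]
  have : (τ - a) / h ≤ 0 := div_nonpos_of_nonpos_of_nonneg (by linarith) hh.le
  have : (0:ℝ) ≤ j := Nat.cast_nonneg _
  linarith

theorem zk_of_ge {m : ℕ} {Δ a h : ℝ} (hh : 0 < h) {K : ℕ} {y τ : ℝ} (hτ : a + K * h ≤ τ) :
    zk m Δ a h K y τ = 0 := by
  unfold zk
  rw [Finset.sum_eq_zero, mul_zero]
  intro j hj
  rw [zB_of_one_le, zero_div]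
  have : (K:ℝ) ≤ (τ - a) / h := by rw [le_div_iff₀ hh]; linarith
  have : (j:ℝ) + 1 ≤ K := by exact_mod_cast (Finset.mem_range.1 hj)
  linarith

theorem zk_pos_near {m : ℕ} (hm : Even m) {Δ : ℝ} (hΔ : Δ ≠ 0) {a h : ℝ} (hh : 0 < h) {K : ℕ}
    (y : ℝ) {c d : ℝ} (hc : a ≤ c) (hcd : c < d) (hd : d ≤ a + K * h) :
    ∃ σ ∈ Ioo c d, 0 < zk m Δ a h K y σ := by
  -- choose a point off the grid
  have hfin : Set.Finite ((fun j : ℕ => a + j * h) '' (Set.Iio (K+1))) := (Set.finite_Iio _).image _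
  obtain ⟨σ, hσ, hσ'⟩ := ((Ioo_infinite hcd).sdiff hfin).nonempty
  refine ⟨σ, hσ, ?_⟩
  have hu0 : 0 ≤ (σ - a) / h := div_nonneg (by linarith [hσ.1]) hh.le
  have hj1 : (⌊(σ - a) / h⌋₊ : ℝ) ≤ (σ - a) / h := Nat.floor_le hu0
  have hj2 := Nat.lt_floor_add_one ((σ - a) / h)
  set j := ⌊(σ - a) / h⌋₊ with hj
  have huK : (σ - a) / h < K := by rw [div_lt_iff₀ hh]; linarith [hσ.2]
  have hjK : j < K := by
    have : (j:ℝ) < K := lt_of_le_of_lt hj1 huK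
    exact_mod_cast this
  have hne : (j:ℝ) ≠ (σ - a) / h := by
    intro h1
    apply hσ'
    refine ⟨j, Set.mem_Iio.2 (by omega), ?_⟩
    simp only
    rw [h1]; field_simp; ring
  have hlt : (j:ℝ) < (σ - a) / h := lt_of_le_of_ne hj1 hne
  unfold zk
  have hK' : (0:ℝ) < K := by exact_mod_cast (by omega : 0 < K)
  refine mul_pos (by positivity) (Finset.sum_pos' (fun i _ => ?_) ⟨j, Finset.mem_range.2 hjK, ?_⟩)
  · exact div_nonneg (zB_nonneg _) (zN_one_pos hm hΔ _ _ _).le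
  · exact div_pos (zB_pos (by linarith) (by linarith)) (zN_one_pos hm hΔ _ _ _)

theorem zA_mono {m : ℕ} (hm : Even m) {Δ : ℝ} (hΔ : Δ ≠ 0) {a h : ℝ} (hh : 0 < h) {K : ℕ}
    (y : ℝ) : Monotone (zA m Δ a h K y) := by
  apply monotone_of_deriv_nonneg (fun τ => (zA_hasDeriv m Δ a hh K y τ).differentiableAt)
  intro τ
  rw [(zA_hasDeriv m Δ a hh K y τ).deriv]
  exact mul_nonneg (hm.pow_nonneg _) (zk_nonneg hm hΔ a hh K y τ)

theorem zphi_of_le {Δ a h : ℝ} (hh : 0 < h) {K : ℕ} {τ : ℝ} (hτ : τ ≤ a) :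
    zphi Δ a h K τ = τ := by
  unfold zphi
  rw [zP_of_nonpos (div_nonpos_of_nonpos_of_nonneg (by linarith) hh.le)]; ring

theorem zphi_of_ge {Δ a h : ℝ} (hh : 0 < h) {K : ℕ} {τ : ℝ} (hτ : a + K * h ≤ τ) :
    zphi Δ a h K τ = τ := by
  unfold zphi
  rw [zP_of_ge (by rw [le_div_iff₀ hh]; linarith)]; ring

theorem zA_clamp {m : ℕ} (hm : Even m) {Δ : ℝ} (hΔ : Δ ≠ 0) {y s t h : ℝ} :
    zG m Δ y s t h = zG m Δ y (max 0 (min s 1)) t h := by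
  rcases le_total s 0 with hs | hs
  · rw [zG_of_nonpos hs, max_eq_left (by rw [min_eq_left (by linarith)]; exact hs),
      zG_of_nonpos le_rfl]
  · rcases le_total s 1 with h1 | h1
    · rw [min_eq_left h1, max_eq_right hs]
    · rw [min_eq_right h1, max_eq_right zero_le_one, zG_of_one_le hm hΔ h1,
        zG_of_one_le hm hΔ le_rfl]

theorem zA_split {m : ℕ} (hm : Even m) {Δ : ℝ} (hΔ : Δ ≠ 0) (a h τ : ℝ) {K : ℕ} (hK : 1 ≤ K) :
    ∃ j < K, ∃ s ∈ Icc (0:ℝ) 1, ∀ y, zA m Δ a h K y τ =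
      j / K + (1 / (K:ℝ)) * zG m Δ y s (a + j * h) h := by
  obtain ⟨j, hj, hi⟩ := zz_floor ((τ - a) / h) hK
  refine ⟨j, hj, max 0 (min ((τ - a) / h - j) 1), ⟨le_max_left _ _, max_le zero_le_one (min_le_right _ _)⟩,
    fun y => ?_⟩
  rw [← zA_clamp hm hΔ]
  unfold zA
  have h1 : ∑ i ∈ Finset.range K, zG m Δ y ((τ - a) / h - i) (a + i * h) h =
      ∑ i ∈ Finset.range K, ((if i < j then 1 else 0) +
        if i = j then zG m Δ y ((τ - a) / h - j) (a + j * h) h else 0) := by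
    refine Finset.sum_congr rfl fun i hiK => ?_
    by_cases hij : i = j
    · subst hij; simp
    · rcases hi i (Finset.mem_range.1 hiK) hij with ⟨h2, h3⟩ | ⟨h2, h3⟩
      · rw [zG_of_one_le hm hΔ h3]; simp [hij, h2]
      · rw [zG_of_nonpos h3]; simp [hij, h2.le.not_gt]
  rw [h1, Finset.sum_add_distrib, Finset.sum_ite_eq']
  have h2 : ∑ i ∈ Finset.range K, (if i < j then (1:ℝ) else 0) = j := by
    rw [← Finset.sum_filter]
    have : (Finset.range K).filter (fun i => i < j) = Finset.range j := by
      ext i; simp; omega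
    rw [this]; simp
  rw [h2, if_pos (Finset.mem_range.2 hj)]
  ring

end part5


section part6

theorem zz_profile {E F : Type} [NormedAddCommGroup E] [NormedSpace ℝ E]
    [NormedAddCommGroup F] [NormedSpace ℝ F] {a b : ℝ} (hab : a < b) (r : ℕ)
    {Q : E → ℝ} (hQ : ContDiff ℝ ∞ Q) {g : E → F} (hg : ContDiff ℝ ∞ g)
    {S : Set E} (hS : IsCompact S) {η : ℝ} (hη : 0 < η) :
    ∃ (φ : ℝ → ℝ) (A k : ℝ → ℝ → ℝ),
      ContDiff ℝ ∞ φ ∧ ContDiff ℝ ∞ (fun z : ℝ × ℝ => A z.1 z.2) ∧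
      ContDiff ℝ ∞ (fun z : ℝ × ℝ => k z.1 z.2) ∧
      (∀ τ ≤ a, φ τ = τ) ∧ (∀ τ, b ≤ τ → φ τ = τ) ∧
      (∀ τ, τ ≤ φ τ) ∧ (∀ τ ≤ b, φ τ ≤ b) ∧
      Dense {τ | deriv φ τ ≠ 0} ∧
      (∀ y τ, HasDerivAt (A y) ((y - φ τ) ^ (2 * r) * k y τ) τ) ∧
      (∀ y, ∀ τ ≤ a, A y τ = 0) ∧ (∀ y τ, b ≤ τ → A y τ = 1) ∧
      (∀ y, ∀ τ ≤ a, k y τ = 0) ∧ (∀ y τ, b ≤ τ → k y τ = 0) ∧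
      (∀ y τ τ', τ < τ' → φ τ = φ τ' → A y τ < A y τ') ∧
      (∀ x ∈ S, ∀ τ, ∃ c ∈ Icc (0:ℝ) 1, ∀ i ≤ r,
        ‖iteratedFDeriv ℝ i (fun x => A (Q x) τ • g x) x - c • iteratedFDeriv ℝ i g x‖ ≤ η) := by
  have hm : Even (2 * r) := even_two_mul r
  set L := (b - a) / 2 with hL
  have hL0 : 0 < L := by rw [hL]; linarith
  obtain ⟨Δ, hΔ0, hΔL, hΔ⟩ := zz_choose_amp hL0
  have hΔn := hΔ0.ne'
  have hΦ : ContDiff ℝ ∞ (fun z : E × (ℝ × ℝ × ℝ) =>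
      zG (2 * r) Δ (Q z.1) z.2.1 z.2.2.1 z.2.2.2 • g z.1) := by
    refine ContDiff.smul ?_ (hg.comp contDiff_fst)
    exact (zG_smooth hm hΔn).comp
      (f := fun z : E × (ℝ × ℝ × ℝ) => (Q z.1, z.2.1, z.2.2.1, z.2.2.2)) (by fun_prop)
  obtain ⟨C, hC0, hC⟩ := zz_bounded hΦ r hS
    ((isCompact_Icc (a := (0:ℝ)) (b := 1)).prod
      ((isCompact_Icc (a := a) (b := b)).prod (isCompact_Icc (a := (0:ℝ)) (b := L))))
  obtain ⟨K, hKC⟩ := exists_nat_gt (max 1 (C / η))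
  have hK1' : (1:ℝ) < K := lt_of_le_of_lt (le_max_left _ _) hKC
  have hK1 : 1 ≤ K := by exact_mod_cast hK1'.le
  have hK0 : (0:ℝ) < K := by linarith
  have hCK : C / K ≤ η := by
    have := lt_of_le_of_lt (le_max_right _ _) hKC
    rw [div_lt_iff₀ hη] at this
    rw [div_le_iff₀ hK0]; linarith
  set h := L / K with hh
  have hh0 : 0 < h := by positivity
  have hKh : K * h = L := by rw [hh]; field_simp
  have hb' : a + K * h ≤ b := by rw [hKh, hL]; linarith
  have hle : ∀ τ, τ ≤ zphi Δ a h K τ := fun τ => by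
    unfold zphi; nlinarith [zP_nonneg K ((τ - a) / h)]
  have hdense : Dense {τ | deriv (zphi Δ a h K) τ ≠ 0} := zphi_dense hΔ0 hh0 (hΔ K hK1)
  have hmono : ∀ y, Monotone (zA (2 * r) Δ a h K y) := fun y => zA_mono hm hΔn hh0 y
  refine ⟨zphi Δ a h K, zA (2 * r) Δ a h K, zk (2 * r) Δ a h K, zphi_smooth _ _ _ _,
    zA_smooth hm hΔn a h K, zk_smooth hm hΔn a h K, fun τ hτ => zphi_of_le hh0 hτ,
    fun τ hτ => zphi_of_ge hh0 (hb'.trans hτ), hle, ?_, hdense,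
    fun y τ => zA_hasDeriv _ Δ a hh0 K y τ, fun y τ hτ => zA_of_le hh0 hτ,
    fun y τ hτ => zA_of_ge hm hΔn hh0 hK1 (hb'.trans hτ), fun y τ hτ => zk_of_le hh0 hτ,
    fun y τ hτ => zk_of_ge hh0 (hb'.trans hτ), ?_, ?_⟩
  · intro τ hτ
    rcases le_total τ (a + K * h) with h1 | h1
    · unfold zphi
      have := zP_le_one K ((τ - a) / h)
      have h2 : Δ * zP K ((τ - a) / h) ≤ Δ := by nlinarith
      rw [hKh] at h1
      have : L + L = b - a := by rw [hL]; ring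
      linarith
    · rw [zphi_of_ge hh0 h1]; exact hτ
  · intro y τ τ' hlt heq
    have h1 : τ < a + K * h := by
      by_contra hc
      push Not at hc
      rw [zphi_of_ge hh0 hc, zphi_of_ge hh0 (hc.trans hlt.le)] at heq
      linarith
    have h2 : a < τ' := by
      by_contra hc
      push Not at hc
      rw [zphi_of_le hh0 hc, zphi_of_le hh0 (hlt.le.trans hc)] at heq
      linarith
    have h3 : a < a + K * h := by rw [hKh]; linarith
    have h4 : max τ a < min τ' (a + K * h) :=
      max_lt (lt_min hlt h1) (lt_min h2 h3)
    have hkc : Continuous (zk (2 * r) Δ a h K y) :=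
      (zk_smooth hm hΔn a h K).continuous.comp (f := fun τ : ℝ => (y, τ)) (by fun_prop)
    calc zA (2 * r) Δ a h K y τ ≤ zA (2 * r) Δ a h K y (max τ a) := hmono y (le_max_left _ _)
      _ < zA (2 * r) Δ a h K y (min τ' (a + K * h)) :=
        zz_strict hm (fun τ => zA_hasDeriv _ Δ a hh0 K y τ) (fun τ => zk_nonneg hm hΔn a hh0 K y τ)
          hkc hdense (fun c d hc hcd hd => zk_pos_near hm hΔn hh0 y hc hcd hd)
          (le_max_right _ _) h4 (min_le_right _ _)
      _ ≤ _ := hmono y (min_le_left _ _)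
  · intro x hx τ
    obtain ⟨j, hj, s, hs, hA⟩ := zA_split hm hΔn a h τ hK1
    have hjK : (j:ℝ) ≤ K := by exact_mod_cast hj.le
    refine ⟨j / K, ⟨by positivity, by rw [div_le_one hK0]; exact hjK⟩, fun i hi => ?_⟩
    have e : (fun x => zA (2 * r) Δ a h K (Q x) τ • g x) =
        ((j / K : ℝ) • g) + ((1 / (K:ℝ)) • fun x => zG (2 * r) Δ (Q x) s (a + j * h) h • g x) := by
      funext x
      simp only [hA, add_smul, Pi.add_apply, Pi.smul_apply, mul_smul]
    have hg' : ContDiff ℝ i g := hg.of_le (by exact_mod_cast le_top)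
    have hG : ContDiff ℝ i (fun x => zG (2 * r) Δ (Q x) s (a + j * h) h • g x) := by
      have : ContDiff ℝ ∞ (fun x => zG (2 * r) Δ (Q x) s (a + j * h) h • g x) :=
        hΦ.comp (f := fun x : E => (x, (s, a + j * h, h))) (by fun_prop)
      exact this.of_le (by exact_mod_cast le_top)
    rw [e, iteratedFDeriv_add_apply (f := (j / K : ℝ) • g)
      (g := (1 / (K:ℝ)) • fun x => zG (2 * r) Δ (Q x) s (a + j * h) h • g x)
      (hg'.const_smul (j / K : ℝ)).contDiffAt (hG.const_smul (1 / (K:ℝ))).contDiffAt, iteratedFDeriv_const_smul_apply hg'.contDiffAt,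
      iteratedFDeriv_const_smul_apply hG.contDiffAt, add_sub_cancel_left, norm_smul]
    have hjh : (j:ℝ) * h ≤ K * h := by gcongr
    have hjh0 : 0 ≤ (j:ℝ) * h := by positivity
    have hhL : h ≤ L := by rw [hh, div_le_iff₀ hK0]; nlinarith
    have := hC i hi x hx (s, a + j * h, h) ⟨hs, ⟨by simp; positivity, by simp; linarith⟩, ⟨hh0.le, hhL⟩⟩
    have hn : ‖(1 / (K:ℝ))‖ = 1 / K := by rw [Real.norm_of_nonneg]; positivity
    rw [hn]
    calc _ ≤ 1 / (K:ℝ) * C := by gcongr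
      _ = C / K := by ring
      _ ≤ η := hCK

end part6


section part7

def zQ {n : ℕ} (M : ℕ) (p : Fin n → ℝ) : ℝ := ∑ i, p i ^ M

theorem zQ_smooth {n : ℕ} (M : ℕ) : ContDiff ℝ ∞ (zQ M : (Fin n → ℝ) → ℝ) := by
  unfold zQ; fun_prop

theorem zQ_smul {n : ℕ} (M : ℕ) (c : ℝ) (p : Fin n → ℝ) : zQ M (c • p) = c ^ M * zQ M p := by
  unfold zQ
  rw [Finset.mul_sum]
  exact Finset.sum_congr rfl fun i _ => by simp [mul_pow]

theorem zQ_coord {n M : ℕ} (hM : Even M) (p : Fin n → ℝ) (i : Fin n) : |p i| ^ M ≤ zQ M p := by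
  rw [hM.pow_abs]
  exact Finset.single_le_sum (f := fun i => p i ^ M) (fun i _ => hM.pow_nonneg _) (Finset.mem_univ i)

theorem zQ_nonneg {n M : ℕ} (hM : Even M) (p : Fin n → ℝ) : 0 ≤ zQ M p :=
  Finset.sum_nonneg fun i _ => hM.pow_nonneg _

theorem zQ_norm_le_one {n M : ℕ} (hM : Even M) (hM0 : M ≠ 0) {p : Fin n → ℝ} (h : zQ M p ≤ 1) :
    ‖p‖ ≤ 1 := by
  rw [pi_norm_le_iff_of_nonneg zero_le_one]
  intro i
  have := (zQ_coord hM p i).trans h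
  rw [Real.norm_eq_abs]
  exact (pow_le_one_iff_of_nonneg (abs_nonneg _) hM0).1 this

theorem zQ_one_le {n M : ℕ} (hM : Even M) (hM0 : M ≠ 0) {p : Fin n → ℝ} (h : 1 ≤ ‖p‖) :
    1 ≤ zQ M p := by
  by_contra hc
  push Not at hc
  have : ‖p‖ < 1 := by
    rw [pi_norm_lt_iff zero_lt_one]
    intro i
    have := lt_of_le_of_lt (zQ_coord hM p i) hc
    rw [Real.norm_eq_abs]
    exact (pow_lt_one_iff_of_nonneg (abs_nonneg _) hM0).1 this
  linarith

theorem zQ_le {n M : ℕ} (hM : Even M) {p : Fin n → ℝ} {ρ : ℝ} (h : ‖p‖ ≤ ρ) :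
    zQ M p ≤ n * ρ ^ M := by
  unfold zQ
  calc ∑ i, p i ^ M ≤ ∑ _i : Fin n, ρ ^ M := by
        refine Finset.sum_le_sum fun i _ => ?_
        rw [← hM.pow_abs]
        have : |p i| ≤ ρ := (norm_le_pi_norm p i).trans h
        gcongr
    _ = n * ρ ^ M := by simp

theorem zz_exists_M (n : ℕ) {ρ : ℝ} (h0 : 0 < ρ) (h1 : ρ < 1) :
    ∃ M : ℕ, Even M ∧ M ≠ 0 ∧ n * ρ ^ M < 1 / 2 := by
  have hn : (0:ℝ) < 2 * (n + 1) := by positivity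
  obtain ⟨k, hk⟩ := exists_pow_lt_of_lt_one (show (0:ℝ) < 1 / (2 * (n+1)) by positivity) h1
  refine ⟨2 * (k + 1), even_two_mul _, by omega, ?_⟩
  have h2 : ρ ^ (2 * (k+1)) ≤ ρ ^ k := pow_le_pow_of_le_one h0.le h1.le (by omega)
  rw [lt_div_iff₀ hn] at hk
  have h3 : 0 < ρ ^ k := by positivity
  have : (n:ℝ) * ρ ^ (2 * (k+1)) ≤ n * ρ ^ k := by gcongr
  nlinarith

theorem zz_radial {φ : ℝ → ℝ} (hφ : ContDiff ℝ ∞ φ) (h1 : ∀ τ ≤ 1/2, φ τ = τ)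
    (h2 : ∀ τ, τ ≤ φ τ) {M : ℕ} (hM0 : M ≠ 0) :
    ∃ c : ℝ → ℝ, ContDiff ℝ ∞ c ∧ (∀ τ, 0 < c τ) ∧ (∀ τ, 0 ≤ τ → c τ ^ M * τ = φ τ) ∧
      (∀ τ, φ τ = τ → c τ = 1) := by
  have hone : ∀ τ, φ τ = τ → Real.exp (Real.log (φ τ / τ) / M) = 1 := by
    intro τ h
    rw [h]
    by_cases h0 : τ = 0
    · simp [h0]
    · simp [div_self h0]
  refine ⟨fun τ => Real.exp (Real.log (φ τ / τ) / M), ?_, fun τ => Real.exp_pos _, ?_, hone⟩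
  · rw [contDiff_iff_contDiffAt]
    intro τ
    by_cases h : τ < 1/2
    · have : (fun τ => Real.exp (Real.log (φ τ / τ) / M)) =ᶠ[𝓝 τ] fun _ => 1 := by
        filter_upwards [isOpen_Iio.mem_nhds h] with t ht
        exact hone t (h1 t (le_of_lt ht))
      exact contDiffAt_const.congr_of_eventuallyEq this
    · push Not at h
      have h0 : 0 < τ := by linarith
      have h3 : 0 < φ τ := lt_of_lt_of_le h0 (h2 τ)
      refine ContDiffAt.exp (ContDiffAt.div_const (ContDiffAt.log ?_ (by positivity)) _)
      exact hφ.contDiffAt.div contDiffAt_id h0.ne'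
  · intro τ hτ
    rcases hτ.eq_or_lt with h | h
    · subst h; rw [mul_zero, h1 0 (by norm_num)]
    · have h3 : 0 < φ τ := lt_of_lt_of_le h (h2 τ)
      simp only
      rw [← Real.exp_nat_mul]
      have hM' : (M:ℝ) ≠ 0 := by exact_mod_cast hM0
      rw [mul_div_cancel₀ _ hM', Real.exp_log (by positivity)]
      field_simp

theorem zz_bij {n : ℕ} {Q : (Fin n → ℝ) → ℝ} (hQ : ContDiff ℝ ∞ Q) {c φ : ℝ → ℝ}
    (hc : ContDiff ℝ ∞ c) (hφ : ContDiff ℝ ∞ φ)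
    (hQX : ∀ p, Q (c (Q p) • p) = φ (Q p)) {p : Fin n → ℝ} (hc0 : c (Q p) ≠ 0)
    (hp : deriv φ (Q p) ≠ 0) : Function.Bijective ⇑(fderiv ℝ (fun p => c (Q p) • p) p) := by
  have hcd : Differentiable ℝ c := hc.differentiable (by simp)
  have hQd : Differentiable ℝ Q := hQ.differentiable (by simp)
  have hφd : Differentiable ℝ φ := hφ.differentiable (by simp)
  have hcQ : HasFDerivAt (fun p => c (Q p)) (deriv c (Q p) • fderiv ℝ Q p) p :=
    (hcd (Q p)).hasDerivAt.comp_hasFDerivAt p (hQd p).hasFDerivAt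
  have hX : HasFDerivAt (fun p => c (Q p) • p) (c (Q p) • ContinuousLinearMap.id ℝ (Fin n → ℝ) +
      (deriv c (Q p) • fderiv ℝ Q p).smulRight p) p := hcQ.smul (hasFDerivAt_id p)
  have h1 : HasFDerivAt (fun p => Q (c (Q p) • p))
      ((fderiv ℝ Q (c (Q p) • p)).comp (fderiv ℝ (fun p => c (Q p) • p) p)) p := by
    have h0 := hX.differentiableAt.hasFDerivAt
    exact HasFDerivAt.comp (f := fun p => c (Q p) • p) p (hQd _).hasFDerivAt h0
  have h2 : HasFDerivAt (fun p => Q (c (Q p) • p)) (deriv φ (Q p) • fderiv ℝ Q p) p := by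
    simp_rw [hQX]
    exact (hφd (Q p)).hasDerivAt.comp_hasFDerivAt p (hQd p).hasFDerivAt
  have h3 := h1.unique h2
  have hinj : Function.Injective ⇑(fderiv ℝ (fun p => c (Q p) • p) p) := by
    rw [injective_iff_map_eq_zero]
    intro v hv
    have h4 := congrArg (fun L => L v) h3
    simp only [ContinuousLinearMap.comp_apply, hv, map_zero, ContinuousLinearMap.smul_apply,
      smul_eq_mul] at h4
    have h5 : fderiv ℝ Q p v = 0 := by
      rcases mul_eq_zero.1 h4.symm with h | h
      · exact absurd h hp
      · exact h
    rw [hX.fderiv] at hv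
    simp [h5] at hv
    exact hv.resolve_left hc0
  refine ⟨hinj, ?_⟩
  exact (LinearMap.injective_iff_surjective
    (f := ((fderiv ℝ (fun p => c (Q p) • p) p : (Fin n → ℝ) →L[ℝ] (Fin n → ℝ)) :
      (Fin n → ℝ) →ₗ[ℝ] (Fin n → ℝ)))).1 hinj

theorem zz_dense {n M : ℕ} (hM : Even M) (hM0 : M ≠ 0) {φ : ℝ → ℝ}
    (h1 : ∀ τ ≤ 1/2, φ τ = τ) (hd : Dense {τ | deriv φ τ ≠ 0}) :
    Dense {p : Fin n → ℝ | deriv φ (zQ M p) ≠ 0} := by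
  rw [dense_iff_inter_open]
  rintro U hU ⟨p, hp⟩
  rcases (zQ_nonneg hM p).eq_or_lt with h | h
  · refine ⟨p, hp, ?_⟩
    have e : φ =ᶠ[𝓝 0] id := by
      filter_upwards [isOpen_Iio.mem_nhds (show (0:ℝ) < 1/2 by norm_num)] with t ht
      exact h1 t (le_of_lt ht)
    change deriv φ (zQ M p) ≠ 0
    rw [← h, e.deriv_eq]; simp
  · set q := zQ M p with hq
    set γ : ℝ → (Fin n → ℝ) := fun s => ((s / q) ^ (1 / (M:ℝ)) : ℝ) • p with hγ
    have hγq : γ q = p := by simp [hγ, div_self h.ne']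
    have hcont : ContinuousAt γ q := by
      have h2 : ContinuousAt (fun s : ℝ => (s / q) ^ (1 / (M:ℝ))) q := by
        refine ContinuousAt.rpow_const (by fun_prop) (Or.inl ?_)
        rw [div_self h.ne']; exact one_ne_zero
      exact h2.smul continuousAt_const
    have hnh : γ ⁻¹' U ∩ Ioi 0 ∈ 𝓝 q :=
      inter_mem (hcont (by rw [hγq]; exact hU.mem_nhds hp)) (isOpen_Ioi.mem_nhds h)
    obtain ⟨s, hsn, hs⟩ := hd.inter_nhds_nonempty hnh
    have hs0 : 0 < s := hs.2
    refine ⟨γ s, hs.1, ?_⟩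
    have e : zQ M (γ s) = s := by
      rw [hγ]
      simp only
      rw [zQ_smul, ← hq, ← Real.rpow_natCast, ← Real.rpow_mul (by positivity)]
      have hM' : (M:ℝ) ≠ 0 := by exact_mod_cast hM0
      rw [one_div_mul_cancel hM', Real.rpow_one]
      field_simp
    change deriv φ (zQ M (γ s)) ≠ 0
    rw [e]; exact hsn

theorem zz_dense_glue {φ φ1 φ2 : ℝ → ℝ} {u v : ℝ} (huv : u < v) (h1 : ∀ τ < v, φ τ = φ1 τ)
    (h2 : ∀ τ, u < τ → φ τ = φ2 τ) (hd1 : Dense {τ | deriv φ1 τ ≠ 0})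
    (hd2 : Dense {τ | deriv φ2 τ ≠ 0}) : Dense {τ | deriv φ τ ≠ 0} := by
  rw [dense_iff_inter_open]
  rintro U hU ⟨p, hp⟩
  rcases lt_or_ge p v with h | h
  · obtain ⟨t, ht, ht'⟩ := hd1.inter_open_nonempty _ (hU.inter isOpen_Iio) ⟨p, hp, h⟩
    refine ⟨t, ht.1, ?_⟩
    have e : φ =ᶠ[𝓝 t] φ1 := by
      filter_upwards [isOpen_Iio.mem_nhds ht.2] with s hs using h1 s hs
    change deriv φ t ≠ 0
    rw [e.deriv_eq]; exact ht'
  · obtain ⟨t, ht, ht'⟩ := hd2.inter_open_nonempty _ (hU.inter isOpen_Ioi)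
      ⟨p, hp, lt_of_lt_of_le huv h⟩
    refine ⟨t, ht.1, ?_⟩
    have e : φ =ᶠ[𝓝 t] φ2 := by
      filter_upwards [isOpen_Ioi.mem_nhds ht.2] with s hs using h2 s hs
    change deriv φ t ≠ 0
    rw [e.deriv_eq]; exact ht'

end part7


section part8

/-- norm estimate -/
theorem zz_estimate {E : Type*} [NormedAddCommGroup E] [NormedSpace ℝ E] {P R f H : E} {ε c d : ℝ}
    (hc : c ∈ Icc (0:ℝ) 1) (hd : d ∈ Icc (0:ℝ) 1) (h1 : ‖P - c • (f + H)‖ ≤ ε)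
    (h2 : ‖R - d • H‖ ≤ ε) (hf : ‖f‖ < ε) (hH : ‖H‖ ≤ ε) : ‖P - R‖ < 5 * ε := by
  have hε : 0 < ε := lt_of_le_of_lt (norm_nonneg _) hf
  have e : P - R = (P - c • (f + H)) - (R - d • H) + c • f + (c - d) • H := by
    rw [smul_add, sub_smul]; abel
  have h3 : ‖c • f‖ ≤ ε := by
    rw [norm_smul, Real.norm_of_nonneg hc.1]
    nlinarith [norm_nonneg f, hc.1, hc.2]
  have h4 : ‖(c - d) • H‖ ≤ ε := by
    rw [norm_smul, Real.norm_eq_abs]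
    have : |c - d| ≤ 1 := by
      rw [abs_le]; constructor <;> linarith [hc.1, hc.2, hd.1, hd.2]
    nlinarith [norm_nonneg H, abs_nonneg (c - d)]
  rw [e]
  calc _ ≤ ‖(P - c • (f + H)) - (R - d • H)‖ + ‖c • f‖ + ‖(c - d) • H‖ := norm_add₃_le
    _ ≤ (‖P - c • (f + H)‖ + ‖R - d • H‖) + ‖c • f‖ + ‖(c - d) • H‖ := by
        gcongr; exact norm_sub_le _ _
    _ < 5 * ε := by linarith

theorem zz_const_bound {E F : Type*} [NormedAddCommGroup E] [NormedSpace ℝ E]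
    [NormedAddCommGroup F] [NormedSpace ℝ F] (H : F) {ε : ℝ} (hε : 0 ≤ ε) (hH : ‖H‖ ≤ ε)
    (i : ℕ) (x : E) : ‖iteratedFDeriv ℝ i (fun _ : E => H) x‖ ≤ ε := by
  rcases Nat.eq_zero_or_pos i with h | h
  · subst h; rwa [norm_iteratedFDeriv_zero]
  · rw [iteratedFDeriv_const_of_ne (by omega)]; simpa using hε

end part8

theorem zz_main
    (n ℓ r : ℕ) (hn : 1 ≤ n) (hℓ : 1 ≤ ℓ) (hr : 1 ≤ r)
    (ε δ : ℝ) (hε : 0 < ε) (hδ0 : 0 < δ) (hδ1 : δ < 1)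
    (s₀ s₁ : Vec n → Vec ℓ)
    (hs₀ : ContDiff ℝ (⊤ : ℕ∞) s₀) (hs₁ : ContDiff ℝ (⊤ : ℕ∞) s₁)
    (hclose : ∀ i ≤ r, ∀ x : Vec n, 1 - δ ≤ ‖x‖ → ‖x‖ ≤ 1 →
      ‖iteratedFDeriv ℝ i s₀ x - iteratedFDeriv ℝ i s₁ x‖ < ε) :
    ∃ (X : Vec n → Vec n) (ζ : (i : ℕ) → Vec n → SymMap n ℓ i),
      ContDiff ℝ (⊤ : ℕ∞) X ∧ (∀ i ≤ r, ContDiff ℝ (⊤ : ℕ∞) (ζ i)) ∧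
      (∀ i ≤ r, ∀ p : Vec n, IsSymmMap (ζ i p)) ∧
      -- (a) equals the holonomic lift of s₀ outside the unit ball
      (∀ p : Vec n, 1 ≤ ‖p‖ → X p = p ∧ ∀ i ≤ r, ζ i p = iteratedFDeriv ℝ i s₀ p) ∧
      -- (b) equals the holonomic lift of s₁ in the inner ball
      (∀ p : Vec n, ‖p‖ ≤ 1 - δ → X p = p ∧ ∀ i ≤ r, ζ i p = iteratedFDeriv ℝ i s₁ p) ∧
      -- (c) integrality
      (∀ i < r, ∀ (p v : Vec n) (w : Fin i → Vec n),
        (fderiv ℝ (ζ i) p v) w = ζ (i + 1) p (Fin.cons (fderiv ℝ X p v) w)) ∧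
      -- (d) dense graphicality locus
      Dense {p : Vec n | Function.Bijective ⇑(fderiv ℝ X p)} ∧
      -- (e) the front is injective on the closed unit ball
      Set.InjOn (fun p => (X p, ζ 0 p)) (Metric.closedBall 0 1) ∧
      -- (f) approximation
      (∀ p : Vec n, ‖p‖ ≤ 1 → ‖X p - p‖ ≤ δ ∧
        ∀ i ≤ r, ‖ζ i p - iteratedFDeriv ℝ i s₁ (X p)‖ < 5 * ε) := by
  obtain ⟨M, hM, hM0, hMn⟩ := zz_exists_M n (show (0:ℝ) < 1 - δ by linarith) (by linarith)
  have hQ : ContDiff ℝ ∞ (zQ M : Vec n → ℝ) := zQ_smooth M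
  have hQout : ∀ p : Vec n, 1 ≤ ‖p‖ → 1 ≤ zQ M p := fun p => zQ_one_le hM hM0
  have hQin : ∀ p : Vec n, ‖p‖ ≤ 1 - δ → zQ M p < 1 / 2 := fun p hp =>
    lt_of_le_of_lt (zQ_le hM hp) hMn
  have hQann : ∀ p : Vec n, 1 / 2 ≤ zQ M p → zQ M p ≤ 1 → 1 - δ ≤ ‖p‖ ∧ ‖p‖ ≤ 1 := by
    intro p h1 h2
    refine ⟨?_, zQ_norm_le_one hM hM0 h2⟩
    by_contra hc
    push Not at hc
    linarith [hQin p hc.le]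
  set H : Vec ℓ := fun _ => ε with hH
  have hHn : ‖H‖ ≤ ε := by
    rw [pi_norm_le_iff_of_nonneg hε.le]; intro i; simp [hH, abs_of_pos hε]
  set f : Vec n → Vec ℓ := fun x => s₀ x - s₁ x with hf
  have hfs : ContDiff ℝ ∞ f := hs₀.sub hs₁
  have hfD : ∀ i : ℕ, ∀ x, iteratedFDeriv ℝ i f x =
      iteratedFDeriv ℝ i s₀ x - iteratedFDeriv ℝ i s₁ x := by
    intro i x
    exact iteratedFDeriv_sub_apply (f := s₀) (g := s₁)
      (hs₀.of_le (by exact_mod_cast le_top)).contDiffAt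
      (hs₁.of_le (by exact_mod_cast le_top)).contDiffAt
  have hS : IsCompact (Metric.closedBall (0 : Vec n) 1) := isCompact_closedBall _ _
  have hg1 : ContDiff ℝ ∞ (fun x => f x + H) := hfs.add contDiff_const
  have hg2 : ContDiff ℝ ∞ (fun _ : Vec n => H) := contDiff_const
  obtain ⟨φ1, A1, k1, hφ1, hA1, hk1, hφ1a, hφ1b, hφ1le, hφ1b', hφ1d, hA1d, hA1a, hA1b, hk1a, hk1b,
    hA1s, hA1e⟩ := zz_profile (show (1/2:ℝ) < 5/8 by norm_num) r hQ hg1 hS hε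
  obtain ⟨φ2, A2, k2, hφ2, hA2, hk2, hφ2a, hφ2b, hφ2le, hφ2b', hφ2d, hA2d, hA2a, hA2b, hk2a, hk2b,
    hA2s, hA2e⟩ := zz_profile (show (3/4:ℝ) < 1 by norm_num) r hQ hg2 hS hε
  obtain ⟨φ, hφdef⟩ : ∃ φ : ℝ → ℝ, φ = fun τ => φ1 τ + φ2 τ - τ := ⟨_, rfl⟩
  have hφ : ContDiff ℝ ∞ φ := by rw [hφdef]; fun_prop
  have e1 : ∀ τ ≤ 3/4, φ τ = φ1 τ := fun τ h => by rw [hφdef]; simp only; rw [hφ2a τ h]; ring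
  have e2 : ∀ τ, 5/8 ≤ τ → φ τ = φ2 τ := fun τ h => by rw [hφdef]; simp only; rw [hφ1b τ h]; ring
  have hφa : ∀ τ ≤ 1/2, φ τ = τ := fun τ h => by rw [e1 τ (by linarith), hφ1a τ h]
  have hφb : ∀ τ, 1 ≤ τ → φ τ = τ := fun τ h => by rw [e2 τ (by linarith), hφ2b τ h]
  have hφle : ∀ τ, τ ≤ φ τ := fun τ => by
    rcases le_total τ (3/4) with h | h
    · rw [e1 τ h]; exact hφ1le τ
    · rw [e2 τ (by linarith)]; exact hφ2le τ
  have hφ1' : ∀ τ ≤ 1, φ τ ≤ 1 := fun τ hτ => by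
    rcases le_total τ (5/8) with h | h
    · rw [e1 τ (by linarith)]; linarith [hφ1b' τ h]
    · rw [e2 τ h]; exact hφ2b' τ hτ
  have hφlt : ∀ τ < 3/4, φ τ < 3/4 := fun τ hτ => by
    rw [e1 τ hτ.le]
    rcases le_total τ (5/8) with h | h
    · linarith [hφ1b' τ h]
    · rw [hφ1b τ h]; exact hτ
  have hφd : Dense {τ | deriv φ τ ≠ 0} :=
    zz_dense_glue (show (5/8:ℝ) < 3/4 by norm_num) (fun τ h => e1 τ h.le) (fun τ h => e2 τ h.le)
      hφ1d hφ2d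
  obtain ⟨c, hc, hc0, hcM, hc1⟩ := zz_radial hφ hφa hφle hM0
  obtain ⟨X, hXdef⟩ : ∃ X : Vec n → Vec n, X = fun p => c (zQ M p) • p := ⟨_, rfl⟩
  have hXs : ContDiff ℝ ∞ X := by rw [hXdef]; exact (hc.comp hQ).smul contDiff_id
  have hQX : ∀ p, zQ M (X p) = φ (zQ M p) := fun p => by
    rw [hXdef]; simp only; rw [zQ_smul, hcM _ (zQ_nonneg hM p)]
  have hXid : ∀ p, φ (zQ M p) = zQ M p → X p = p := fun p h => by
    rw [hXdef]; simp only; rw [hc1 _ h, one_smul]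
  obtain ⟨Φ, hΦdef⟩ : ∃ Φ : Vec n × ℝ → Vec ℓ, Φ = fun z =>
    A1 (zQ M z.1) z.2 • (f z.1 + H) - A2 (zQ M z.1) z.2 • H + s₁ z.1 := ⟨_, rfl⟩
  have hQz : ContDiff ℝ ∞ (fun z : Vec n × ℝ => (zQ M z.1, z.2)) :=
    (hQ.comp contDiff_fst).prodMk contDiff_snd
  have hA1z : ContDiff ℝ ∞ (fun z : Vec n × ℝ => A1 (zQ M z.1) z.2) := hA1.comp hQz
  have hA2z : ContDiff ℝ ∞ (fun z : Vec n × ℝ => A2 (zQ M z.1) z.2) := hA2.comp hQz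
  have hk1z : ContDiff ℝ ∞ (fun z : Vec n × ℝ => k1 (zQ M z.1) z.2) := hk1.comp hQz
  have hk2z : ContDiff ℝ ∞ (fun z : Vec n × ℝ => k2 (zQ M z.1) z.2) := hk2.comp hQz
  have hg1z : ContDiff ℝ ∞ (fun z : Vec n × ℝ => f z.1 + H) := hg1.comp contDiff_fst
  have hΦ : ContDiff ℝ ∞ Φ := by
    rw [hΦdef]
    exact ((hA1z.smul hg1z).sub (hA2z.smul contDiff_const)).add (hs₁.comp contDiff_fst)
  have hψ : ContDiff ℝ ∞ (fun z : Vec n × ℝ => zQ M z.1 - φ z.2) :=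
    (hQ.comp contDiff_fst).sub (hφ.comp contDiff_snd)
  have hκ : ContDiff ℝ ∞ (fun z : Vec n × ℝ =>
      k1 (zQ M z.1) z.2 • (f z.1 + H) - k2 (zQ M z.1) z.2 • H) :=
    (hk1z.smul hg1z).sub (hk2z.smul contDiff_const)
  have hd : ∀ z : Vec n × ℝ, fderiv ℝ Φ z (0, 1) = (zQ M z.1 - φ z.2) ^ (2 * r) •
      (k1 (zQ M z.1) z.2 • (f z.1 + H) - k2 (zQ M z.1) z.2 • H) := by
    rintro ⟨x, τ⟩
    have h1 : HasDerivAt (fun t : ℝ => Φ (x, t)) (fderiv ℝ Φ (x, τ) (0, 1)) τ := by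
      have hΦd := (hΦ.differentiable (by simp) (x, τ)).hasFDerivAt
      exact hΦd.comp_hasDerivAt (f := fun t : ℝ => (x, t)) τ
        ((hasDerivAt_const τ x).prodMk (hasDerivAt_id τ))
    have h2 : HasDerivAt (fun t : ℝ => Φ (x, t))
        (((zQ M x - φ1 τ) ^ (2 * r) * k1 (zQ M x) τ) • (f x + H) -
          ((zQ M x - φ2 τ) ^ (2 * r) * k2 (zQ M x) τ) • H) τ := by
      rw [hΦdef]
      exact (((hA1d (zQ M x) τ).smul_const (f x + H)).sub
        ((hA2d (zQ M x) τ).smul_const H)).add_const (s₁ x)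
    rw [h1.unique h2]
    have h3 : (zQ M x - φ1 τ) ^ (2 * r) * k1 (zQ M x) τ =
        (zQ M x - φ τ) ^ (2 * r) * k1 (zQ M x) τ := by
      rcases le_total τ (3/4) with h | h
      · rw [e1 τ h]
      · rw [hk1b _ τ (by linarith)]; simp
    have h4 : (zQ M x - φ2 τ) ^ (2 * r) * k2 (zQ M x) τ =
        (zQ M x - φ τ) ^ (2 * r) * k2 (zQ M x) τ := by
      rcases le_total τ (5/8) with h | h
      · rw [hk2a _ τ (by linarith)]; simp
      · rw [e2 τ h]
    rw [h3, h4, smul_sub, mul_smul, mul_smul]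
  have hΦx : ∀ τ, ContDiff ℝ ∞ (fun x => Φ (x, τ)) := fun τ =>
    hΦ.comp (f := fun x : Vec n => (x, τ)) (by fun_prop)
  have hΦlow : ∀ τ ≤ 1/2, (fun x => Φ (x, τ)) = s₁ := fun τ h => by
    funext x; rw [hΦdef]; simp only
    rw [hA1a _ τ h, hA2a _ τ (by linarith)]; simp
  have hΦhigh : ∀ τ, 1 ≤ τ → (fun x => Φ (x, τ)) = s₀ := fun τ h => by
    funext x; rw [hΦdef]; simp only
    rw [hA1b _ τ (by linarith), hA2b _ τ h]; simp [hf]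
  -- position of the image point
  have hXann : ∀ p, 1/2 ≤ zQ M p → zQ M p ≤ 1 → 1 - δ ≤ ‖X p‖ ∧ ‖X p‖ ≤ 1 := fun p h1 h2 =>
    hQann _ (by rw [hQX]; linarith [hφle (zQ M p)]) (by rw [hQX]; exact hφ1' _ h2)
  refine ⟨X, fun i p => iteratedFDeriv ℝ i (fun x => Φ (x, zQ M p)) (X p), hXs,
    fun i _ => zz_partial_smooth hΦ i hXs hQ, ?_, ?_, ?_, ?_, ?_, ?_, ?_⟩
  · intro i _ p e v
    exact zz_symm (hΦx _) e (X p) v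
  · intro p hp
    have hq := hQout p hp
    have hX := hXid p (hφb _ hq)
    refine ⟨hX, fun i _ => ?_⟩
    simp only
    rw [hΦhigh _ hq, hX]
  · intro p hp
    have hq := hQin p hp
    have hX := hXid p (hφa _ hq.le)
    refine ⟨hX, fun i _ => ?_⟩
    simp only
    rw [hΦlow _ hq.le, hX]
  · intro i hi p v w
    exact zz_integral hΦ hXs hQ hψ hκ hd (fun p => by simp only; rw [hQX, sub_self]) i
      (by omega) p v w
  · refine (zz_dense hM hM0 hφa hφd).mono fun p hp => ?_
    have hQX' : ∀ p : Vec n, zQ M (c (zQ M p) • p) = φ (zQ M p) := fun p => by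
      have := hQX p; rw [hXdef] at this; exact this
    have := zz_bij hQ hc hφ hQX' (hc0 (zQ M p)).ne' hp
    rw [hXdef]; exact this
  · -- injectivity of the front
    have key : ∀ p p' : Vec n, X p = X p' → zQ M p < zQ M p' →
        Φ (X p, zQ M p) ≠ Φ (X p', zQ M p') := by
      intro p p' hX hlt heq
      have hφeq : φ (zQ M p) = φ (zQ M p') := by rw [← hQX, ← hQX, hX]
      set τ := zQ M p
      set τ' := zQ M p'
      rw [← hX] at heq
      set x := X p with hx
      rw [hΦdef] at heq
      simp only at heq
      have h5 := congrFun heq ⟨0, hℓ⟩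
      simp only [Pi.add_apply, Pi.sub_apply, Pi.smul_apply, smul_eq_mul] at h5
      have hHe : H ⟨0, hℓ⟩ = ε := rfl
      rcases lt_or_ge τ' (3/4) with h | h
      · have hs := hA1s (zQ M x) τ τ' hlt (by rw [← e1 τ (by linarith), ← e1 τ' h.le, hφeq])
        rw [hA2a _ τ (by linarith), hA2a _ τ' h.le] at h5
        -- x lies in the annulus
        have hτ'1 : 1/2 < τ' := by
          by_contra hc
          push Not at hc
          rw [hφa τ' hc, hφa τ (by linarith)] at hφeq
          linarith
        have hxa : 1 - δ ≤ ‖x‖ ∧ ‖x‖ ≤ 1 := by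
          rw [hX]; exact hXann p' hτ'1.le (by change τ' ≤ 1; linarith)
        have hfx : ‖f x‖ < ε := by
          have := hclose 0 (Nat.zero_le _) x hxa.1 hxa.2
          rw [← hfD 0 x, norm_iteratedFDeriv_zero] at this
          exact this
        have hf0 : |f x ⟨0, hℓ⟩| < ε := lt_of_le_of_lt (norm_le_pi_norm (f x) ⟨0, hℓ⟩) hfx
        have hpos : 0 < f x ⟨0, hℓ⟩ + H ⟨0, hℓ⟩ := by rw [hHe]; linarith [(abs_lt.1 hf0).1]
        nlinarith
      · have hτ : 3/4 ≤ τ := by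
          by_contra hc
          push Not at hc
          linarith [hφlt τ hc, hφle τ']
        have hs := hA2s (zQ M x) τ τ' hlt
          (by rw [← e2 τ (by linarith), ← e2 τ' (by linarith), hφeq])
        rw [hA1b _ τ (by linarith), hA1b _ τ' (by linarith), hHe] at h5
        nlinarith
    intro p hp p' hp' heq
    simp only [Prod.mk.injEq] at heq
    obtain ⟨hX, h0⟩ := heq
    have h1 : Φ (X p, zQ M p) = Φ (X p', zQ M p') := by
      have := congrArg (fun L => L 0) h0
      simpa using this
    rcases lt_trichotomy (zQ M p) (zQ M p') with h | h | h
    · exact absurd h1 (key p p' hX h)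
    · rw [hXdef] at hX
      simp only [h] at hX
      exact smul_right_injective _ (hc0 (zQ M p')).ne' hX
    · exact absurd h1.symm (key p' p hX.symm h)
  · intro p hp
    rcases le_total (zQ M p) (1/2) with h | h
    · rw [hXid p (hφa _ h)]
      refine ⟨by simpa using hδ0.le, fun i _ => ?_⟩
      simp only
      rw [hXid p (hφa _ h), hΦlow _ h]
      simpa using hε
    · have hτ : zQ M p ≤ 1 ∨ 1 ≤ zQ M p := le_total _ _
      have hann : (1 - δ ≤ ‖X p‖ ∧ ‖X p‖ ≤ 1) ∧ ‖X p - p‖ ≤ δ := by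
        have hpa : 1 - δ ≤ ‖p‖ := by
          by_contra hc
          push Not at hc
          linarith [hQin p hc.le]
        rcases hτ with h1 | h1
        · have hXa := hXann p h h1
          refine ⟨hXa, ?_⟩
          have e : X p - p = (c (zQ M p) - 1) • p := by rw [hXdef, sub_smul, one_smul]
          have e' : ‖X p‖ = c (zQ M p) * ‖p‖ := by
            rw [hXdef]; simp only; rw [norm_smul, Real.norm_of_nonneg (hc0 _).le]
          rw [e, norm_smul, Real.norm_eq_abs, ← abs_of_nonneg (norm_nonneg p), ← abs_mul,
            sub_mul, one_mul, ← e', abs_le]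
          constructor <;> linarith [hXa.1, hXa.2]
        · have hX := hXid p (hφb _ h1)
          rw [hX]
          exact ⟨⟨hpa, hp⟩, by simpa using hδ0.le⟩
      refine ⟨hann.2, fun i hi => ?_⟩
      simp only
      have hxS : X p ∈ Metric.closedBall (0 : Vec n) 1 := by
        rw [mem_closedBall_zero_iff]; exact hann.1.2
      obtain ⟨c1, hc1', hb1⟩ := hA1e (X p) hxS (zQ M p)
      obtain ⟨c2, hc2', hb2⟩ := hA2e (X p) hxS (zQ M p)
      have hb1' := hb1 i hi
      have hb2' := hb2 i hi
      have hle : (i : WithTop ℕ∞) ≤ ∞ := by exact_mod_cast le_top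
      have hP1 : ContDiff ℝ ∞ (fun x => A1 (zQ M x) (zQ M p) • (f x + H)) :=
        (hA1z.smul hg1z).comp (f := fun x : Vec n => (x, zQ M p)) (by fun_prop)
      have hP2 : ContDiff ℝ ∞ (fun x => A2 (zQ M x) (zQ M p) • H) :=
        (hA2z.smul contDiff_const).comp (f := fun x : Vec n => (x, zQ M p)) (by fun_prop)
      have eΦ : (fun x => Φ (x, zQ M p)) = ((fun x => A1 (zQ M x) (zQ M p) • (f x + H)) -
          (fun x => A2 (zQ M x) (zQ M p) • H)) + s₁ := by
        rw [hΦdef]; rfl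
      rw [eΦ, iteratedFDeriv_add_apply (f := (fun x => A1 (zQ M x) (zQ M p) • (f x + H)) -
          (fun x => A2 (zQ M x) (zQ M p) • H)) ((hP1.sub hP2).of_le hle).contDiffAt
          (hs₁.of_le hle).contDiffAt, add_sub_cancel_right,
        iteratedFDeriv_sub_apply (hP1.of_le hle).contDiffAt (hP2.of_le hle).contDiffAt]
      have eg : iteratedFDeriv ℝ i (fun x => f x + H) (X p) = iteratedFDeriv ℝ i f (X p) +
          iteratedFDeriv ℝ i (fun _ : Vec n => H) (X p) :=
        iteratedFDeriv_add_apply (f := f) (g := fun _ : Vec n => H) (hfs.of_le hle).contDiffAt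
          (hg2.of_le hle).contDiffAt
      rw [eg] at hb1'
      refine zz_estimate hc1' hc2' hb1' hb2' ?_ (zz_const_bound H hε.le hHn i _)
      rw [hfD]
      exact hclose i hi (X p) hann.1.1 hann.1.2

end zzparts

/-- Interpolation using zig-zags (del Pino–Toussaint, Proposition 7.3),
in standard coordinates on the unit ball. -/
theorem interpolation_using_zigzags
    (n ℓ r : ℕ) (hn : 1 ≤ n) (hℓ : 1 ≤ ℓ) (hr : 1 ≤ r)
    (ε δ : ℝ) (hε : 0 < ε) (hδ0 : 0 < δ) (hδ1 : δ < 1)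
    (s₀ s₁ : Vec n → Vec ℓ)
    (hs₀ : ContDiff ℝ (⊤ : ℕ∞) s₀) (hs₁ : ContDiff ℝ (⊤ : ℕ∞) s₁)
    (hclose : ∀ i ≤ r, ∀ x : Vec n, 1 - δ ≤ ‖x‖ → ‖x‖ ≤ 1 →
      ‖iteratedFDeriv ℝ i s₀ x - iteratedFDeriv ℝ i s₁ x‖ < ε) :
    ∃ (X : Vec n → Vec n) (ζ : (i : ℕ) → Vec n → SymMap n ℓ i),
      ContDiff ℝ (⊤ : ℕ∞) X ∧ (∀ i ≤ r, ContDiff ℝ (⊤ : ℕ∞) (ζ i)) ∧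
      (∀ i ≤ r, ∀ p : Vec n, IsSymmMap (ζ i p)) ∧
      -- (a) equals the holonomic lift of s₀ outside the unit ball
      (∀ p : Vec n, 1 ≤ ‖p‖ → X p = p ∧ ∀ i ≤ r, ζ i p = iteratedFDeriv ℝ i s₀ p) ∧
      -- (b) equals the holonomic lift of s₁ in the inner ball
      (∀ p : Vec n, ‖p‖ ≤ 1 - δ → X p = p ∧ ∀ i ≤ r, ζ i p = iteratedFDeriv ℝ i s₁ p) ∧
      -- (c) integrality
      (∀ i < r, ∀ (p v : Vec n) (w : Fin i → Vec n),
        (fderiv ℝ (ζ i) p v) w = ζ (i + 1) p (Fin.cons (fderiv ℝ X p v) w)) ∧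
      -- (d) dense graphicality locus
      Dense {p : Vec n | Function.Bijective ⇑(fderiv ℝ X p)} ∧
      -- (e) the front is injective on the closed unit ball
      Set.InjOn (fun p => (X p, ζ 0 p)) (Metric.closedBall 0 1) ∧
      -- (f) approximation
      (∀ p : Vec n, ‖p‖ ≤ 1 → ‖X p - p‖ ≤ δ ∧
        ∀ i ≤ r, ‖ζ i p - iteratedFDeriv ℝ i s₁ (X p)‖ < 5 * ε) := by
  exact zz_main n ℓ r hn hℓ hr ε δ hε hδ0 hδ1 s₀ s₁ hs₀ hs₁ hclose
end
end

section
/- (Existence of swallowtail families of bump functions; Proposition 8.7 of del Pino–Toussaint, stated with the O(1/N) estimate in ε-form, singularity classification weakened to the multi-section conditions.) Fix an integer r ≥ 1, real numbers a < b, and ε > 0. Then there exist jointly smooth functions x, z_0, z_1, …, z_r : ℝ × ℝ → ℝ (arguments (s,t), with s the parameter) and a smooth function h : ℝ → [0,1] with h(s) = 0 for s ≤ 0 and h(s) = 1 for s ≥ 1, such that: (a) for s ≤ 0: x(s,t) = t and z_i(s,t) = 0 for all 0 ≤ i ≤ r and all t; (b) for t ≥ b: x(s,t) = t and z_i(s,t)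 = 0 for all i and all s; (c) for t ≤ a: x(s,t) = t, z_0(s,t) = h(s), and z_i(s,t) = 0 for 1 ≤ i ≤ r; (d) fibrewise integrality: ∂_t z_i(s,t) = z_{i+1}(s,t) · ∂_t x(s,t) for all 0 ≤ i < r and all (s,t); (e) for every s, the front t ↦ (x(s,t), z_0(s,t)) is injective; (f) for every s, the set {t : ∂_t x(s,t) ≠ 0} is dense in ℝ; (g) |z_i(s,t)| < ε for all 1 ≤ i ≤ r and all (s,t). In particular the family interpolates between the zero section (at s ≤ 0) and a zig-zag bump function interpolating between 1 and 0 (at s ≥ 1). -/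
open Set Filter Topology

namespace Swallow

noncomputable def ph (a b t : ℝ) : ℝ := expNegInvGlue (t - a) * expNegInvGlue (b - t)

noncomputable def vv (a b : ℝ) (p : ℝ × ℝ) : ℝ := p.1 + (1 - p.1) * deriv (ph a b) p.2

/-- partial derivative in the second variable -/
noncomputable def DD (f : ℝ × ℝ → ℝ) (p : ℝ × ℝ) : ℝ := deriv (fun t => f (p.1, t)) p.2

theorem ph_contDiff (a b : ℝ) : ContDiff ℝ (⊤ : ℕ∞) (ph a b) := by
  unfold ph
  exact (expNegInvGlue.contDiff.comp (contDiff_id.sub contDiff_const)).mul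
    (expNegInvGlue.contDiff.comp (contDiff_const.sub contDiff_id))

theorem dph_contDiff (a b : ℝ) : ContDiff ℝ (⊤ : ℕ∞) (deriv (ph a b)) :=
  (contDiff_infty_iff_deriv.1 (ph_contDiff a b)).2

theorem ph_diff (a b : ℝ) : Differentiable ℝ (ph a b) :=
  (contDiff_infty_iff_deriv.1 (ph_contDiff a b)).1

theorem ph_left {a b t : ℝ} (h : t ≤ a) : ph a b t = 0 := by
  simp [ph, expNegInvGlue.zero_of_nonpos (sub_nonpos.2 h)]

theorem ph_right {a b t : ℝ} (h : b ≤ t) : ph a b t = 0 := by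
  simp [ph, expNegInvGlue.zero_of_nonpos (sub_nonpos.2 h)]

theorem ph_nonneg (a b t : ℝ) : 0 ≤ ph a b t :=
  mul_nonneg (expNegInvGlue.nonneg _) (expNegInvGlue.nonneg _)

theorem ph_pos {a b t : ℝ} (h : a < t) (h' : t < b) : 0 < ph a b t :=
  mul_pos (expNegInvGlue.pos_of_pos (sub_pos.2 h)) (expNegInvGlue.pos_of_pos (sub_pos.2 h'))

theorem glue_analytic {x : ℝ} (hx : 0 < x) : AnalyticAt ℝ expNegInvGlue x := by
  have h : AnalyticAt ℝ (fun x : ℝ => Real.exp (-x⁻¹)) x :=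
    ((analyticAt_id.inv hx.ne').neg).rexp
  refine h.congr ?_
  filter_upwards [lt_mem_nhds hx] with y hy
  simp [expNegInvGlue, not_le.2 hy]

theorem ph_analytic (a b : ℝ) : AnalyticOnNhd ℝ (ph a b) (Ioo a b) := by
  intro t ht
  have h1 : AnalyticAt ℝ (fun t : ℝ => expNegInvGlue (t - a)) t :=
    AnalyticAt.fun_comp (glue_analytic (sub_pos.2 ht.1)) (analyticAt_id.sub analyticAt_const)
  have h2 : AnalyticAt ℝ (fun t : ℝ => expNegInvGlue (b - t)) t :=
    AnalyticAt.fun_comp (glue_analytic (sub_pos.2 ht.2)) (analyticAt_const.sub analyticAt_id)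
  exact h1.mul h2

theorem key {a b α t₀ : ℝ} (h : ∀ᶠ t in 𝓝 t₀, vv a b (α, t) = 0) : ph a b t₀ = 0 := by
  by_contra hne
  have h1 : a < t₀ := by
    by_contra hc; exact hne (ph_left (not_lt.1 hc))
  have h2 : t₀ < b := by
    by_contra hc; exact hne (ph_right (not_lt.1 hc))
  have hα : α ≠ 1 := by
    rintro rfl
    have := h.self_of_nhds
    simp [vv] at this
  have hα' : 1 - α ≠ 0 := sub_ne_zero.2 hα.symm
  have hev : deriv (ph a b) =ᶠ[𝓝 t₀] fun _ => -α / (1 - α) := by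
    filter_upwards [h] with t ht
    simp only [vv] at ht
    rw [eq_div_iff hα']; linarith
  have hE := (ph_analytic a b).deriv.eqOn_of_preconnected_of_eventuallyEq
    (analyticOnNhd_const) isPreconnected_Ioo ⟨h1, h2⟩ hev
  obtain ⟨ξ, hξ, e1⟩ := exists_deriv_eq_slope (ph a b) (h1.trans h2)
    (ph_diff a b).continuous.continuousOn (ph_diff a b).differentiableOn
  obtain ⟨ζ, hζ, e2⟩ := exists_deriv_eq_slope (ph a b) h1
    (ph_diff a b).continuous.continuousOn (ph_diff a b).differentiableOn
  have e3 := hE hξ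
  have e4 := hE (show ζ ∈ Ioo a b from ⟨hζ.1, hζ.2.trans h2⟩)
  simp only at e3 e4
  rw [ph_left le_rfl, ph_right le_rfl] at e1
  rw [ph_left le_rfl] at e2
  rw [e4, ← e3, e1] at e2
  simp only [sub_zero, zero_div] at e2
  have := div_ne_zero hne (sub_pos.2 h1).ne'
  exact this e2.symm

theorem vv_contDiff (a b : ℝ) : ContDiff ℝ (⊤ : ℕ∞) (vv a b) := by
  unfold vv
  exact contDiff_fst.add ((contDiff_const.sub contDiff_fst).mul
    ((dph_contDiff a b).comp contDiff_snd))

theorem hasDD {f : ℝ × ℝ → ℝ} (hf : ContDiff ℝ (⊤ : ℕ∞) f) (α t : ℝ) :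
    HasDerivAt (fun t => f (α, t)) (DD f (α, t)) t := by
  have : ContDiff ℝ (⊤ : ℕ∞) (fun t : ℝ => f (α, t)) :=
    hf.comp (contDiff_const.prodMk contDiff_id)
  exact ((contDiff_infty_iff_deriv.1 this).1 t).hasDerivAt

theorem DD_contDiff {f : ℝ × ℝ → ℝ} (hf : ContDiff ℝ (⊤ : ℕ∞) f) :
    ContDiff ℝ (⊤ : ℕ∞) (DD f) := by
  have h1 : ContDiff ℝ (⊤ : ℕ∞) (fun p => fderiv ℝ f p (0, 1)) :=
    (hf.fderiv_right (m := (⊤ : ℕ∞)) (by simp)).clm_apply contDiff_const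
  have : DD f = fun p => fderiv ℝ f p (0, 1) := by
    funext p
    have hd : HasFDerivAt f (fderiv ℝ f p) (p.1, p.2) :=
      (hf.differentiable (by simp) p).hasFDerivAt
    have := hd.comp_hasDerivAt p.2 ((hasDerivAt_const p.2 p.1).prodMk (hasDerivAt_id p.2))
    exact this.deriv
  rw [this]; exact h1

theorem DD_left {f : ℝ × ℝ → ℝ} (hf : ContDiff ℝ (⊤ : ℕ∞) f) {a : ℝ}
    (h : ∀ α, ∀ t ≤ a, f (α, t) = 0) : ∀ α, ∀ t ≤ a, DD f (α, t) = 0 := by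
  intro α t ht
  have h1 := (hasDD hf α t).hasDerivWithinAt (s := Iic t)
  have h2 : HasDerivWithinAt (fun t => f (α, t)) 0 (Iic t) t :=
    (hasDerivWithinAt_const t (Iic t) (0 : ℝ)).congr
      (fun y hy => h α y (le_trans hy ht)) (h α t ht)
  exact (uniqueDiffWithinAt_Iic t).eq_deriv _ h1 h2

theorem DD_right {f : ℝ × ℝ → ℝ} (hf : ContDiff ℝ (⊤ : ℕ∞) f) {b : ℝ}
    (h : ∀ α, ∀ t, b ≤ t → f (α, t) = 0) : ∀ α, ∀ t, b ≤ t → DD f (α, t) = 0 := by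
  intro α t ht
  have h1 := (hasDD hf α t).hasDerivWithinAt (s := Ici t)
  have h2 : HasDerivWithinAt (fun t => f (α, t)) 0 (Ici t) t :=
    (hasDerivWithinAt_const t (Ici t) (0 : ℝ)).congr
      (fun y hy => h α y (le_trans ht hy)) (h α t ht)
  exact (uniqueDiffWithinAt_Ici t).eq_deriv _ h1 h2

noncomputable def gg (r : ℕ) (a b : ℝ) : ℕ → ℝ × ℝ → ℝ
  | 0 => fun p => ph a b p.2
  | k + 1 => fun p => ((2 * (r - 1 - k) + 1 : ℕ) : ℝ) * DD (vv a b) p * gg r a b k p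
      + vv a b p * DD (gg r a b k) p

theorem gg_contDiff (r : ℕ) (a b : ℝ) (k : ℕ) : ContDiff ℝ (⊤ : ℕ∞) (gg r a b k) := by
  induction k with
  | zero => exact (ph_contDiff a b).comp contDiff_snd
  | succ k ih =>
    exact ((contDiff_const.mul (DD_contDiff (vv_contDiff a b))).mul ih).add
      ((vv_contDiff a b).mul (DD_contDiff ih))

theorem gg_left (r : ℕ) (a b : ℝ) (k : ℕ) : ∀ α, ∀ t ≤ a, gg r a b k (α, t) = 0 := by
  induction k with
  | zero => intro α t ht; exact ph_left ht
  | succ k ih =>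
    intro α t ht
    simp [gg, ih α t ht, DD_left (gg_contDiff r a b k) ih α t ht]

theorem gg_right (r : ℕ) (a b : ℝ) (k : ℕ) : ∀ α, ∀ t, b ≤ t → gg r a b k (α, t) = 0 := by
  induction k with
  | zero => intro α t ht; exact ph_right ht
  | succ k ih =>
    intro α t ht
    simp [gg, ih α t ht, DD_right (gg_contDiff r a b k) ih α t ht]

theorem exists_prim {f : ℝ → ℝ} (hf : ContDiff ℝ (⊤ : ℕ∞) f) (b : ℝ) :
    ∃ F : ℝ → ℝ, ContDiff ℝ (⊤ : ℕ∞) F ∧ (∀ t, HasDerivAt F (f t) t) ∧ F b = 0 := by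
  have hd : ∀ t, HasDerivAt (fun t => ∫ u in b..t, f u) (f t) t := fun t =>
    intervalIntegral.integral_hasDerivAt_right (hf.continuous.intervalIntegrable _ _)
      hf.continuous.stronglyMeasurable.stronglyMeasurableAtFilter hf.continuous.continuousAt
  refine ⟨fun t => ∫ u in b..t, f u, ?_, hd, by simp⟩
  refine contDiff_infty_iff_deriv.2 ⟨fun t => (hd t).differentiableAt, ?_⟩
  rw [show deriv (fun t => ∫ u in b..t, f u) = f from funext fun t => (hd t).deriv]
  exact hf

theorem exists_W (r : ℕ) (a b : ℝ) : ∃ W : ℝ × ℝ → ℝ, ContDiff ℝ (⊤ : ℕ∞) W ∧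
    (∀ α t, HasDerivAt (fun t => W (α, t)) (vv a b (α, t) ^ (2 * r) * ph a b t) t) ∧
    ∀ α, W (α, b) = 0 := by
  have : ∀ j : ℕ, ∃ F : ℝ → ℝ, ContDiff ℝ (⊤ : ℕ∞) F ∧
      (∀ t, HasDerivAt F (deriv (ph a b) t ^ j * ph a b t) t) ∧ F b = 0 := fun j =>
    exists_prim (((dph_contDiff a b).pow j).mul (ph_contDiff a b)) b
  choose F hF hF' hFb using this
  refine ⟨fun p => ∑ j ∈ Finset.range (2 * r + 1),
    p.1 ^ j * (1 - p.1) ^ (2 * r - j) * ((2 * r).choose j : ℝ) * F (2 * r - j) p.2, ?_, ?_, ?_⟩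
  · refine ContDiff.sum fun j _ => ?_
    exact (((contDiff_fst.pow j).mul ((contDiff_const.sub contDiff_fst).pow _)).mul
      contDiff_const).mul ((hF _).comp contDiff_snd)
  · intro α t
    have h := HasDerivAt.fun_sum (u := Finset.range (2 * r + 1)) (x := t)
      (A := fun j t => α ^ j * (1 - α) ^ (2 * r - j) * ((2 * r).choose j : ℝ) * F (2 * r - j) t)
      (fun j _ => (hF' (2 * r - j) t).const_mul _)
    refine HasDerivAt.congr_deriv h ?_
    simp only [vv]
    rw [add_pow, Finset.sum_mul]
    refine Finset.sum_congr rfl fun j _ => ?_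
    rw [mul_pow]; ring
  · intro α
    simp [hFb]

theorem exists_Z (r : ℕ) (hr : 1 ≤ r) (a b : ℝ) : ∃ Z : ℕ → ℝ × ℝ → ℝ,
    (∀ i, ContDiff ℝ (⊤ : ℕ∞) (Z i)) ∧
    (∀ i < r, ∀ α t, HasDerivAt (fun t => Z i (α, t)) (Z (i + 1) (α, t) * vv a b (α, t)) t) ∧
    (∀ α t, HasDerivAt (fun t => Z 0 (α, t)) (vv a b (α, t) ^ (2 * r) * ph a b t) t) ∧
    (∀ i α t, b ≤ t → Z i (α, t) = 0) ∧
    (∀ i α t, 1 ≤ i → t ≤ a → Z i (α, t) = 0) ∧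
    (∀ α t, t ≤ a → Z 0 (α, t) = Z 0 (α, a)) := by
  obtain ⟨W, hW, hW', hWb⟩ := exists_W r a b
  have hdiff : ∀ α, Differentiable ℝ (fun t => W (α, t)) := fun α t => (hW' α t).differentiableAt
  refine ⟨fun i => match i with
    | 0 => W
    | k + 1 => fun p => vv a b p ^ (2 * (r - 1 - k) + 1) * gg r a b k p, ?_, ?_, hW', ?_, ?_, ?_⟩
  · rintro (_ | k)
    · exact hW
    · exact ((vv_contDiff a b).pow _).mul (gg_contDiff r a b k)
  · rintro (_ | k) hk α t
    · convert hW' α t using 1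
      obtain ⟨q, rfl⟩ : ∃ q, r = q + 1 := ⟨r - 1, by omega⟩
      simp [gg]; ring
    · have h := ((hasDD (vv_contDiff a b) α t).pow (2 * (r - 1 - k) + 1)).mul
        (hasDD (gg_contDiff r a b k) α t)
      refine HasDerivAt.congr_deriv h ?_
      obtain ⟨q, rfl⟩ : ∃ q, r = q + k + 2 := ⟨r - k - 2, by omega⟩
      have e1 : q + k + 2 - 1 - k = q + 1 := by omega
      have e2 : q + k + 2 - 1 - (k + 1) = q := by omega
      simp only [gg, e1, e2]
      push_cast
      simp only [Nat.add_sub_cancel, Pi.pow_apply]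
      ring
  · rintro (_ | k) α t ht
    · have : Convex ℝ (Ici b) := convex_Ici b
      have h := this.is_const_of_fderivWithin_eq_zero (𝕜 := ℝ) (f := fun t => W (α, t))
        (hdiff α).differentiableOn ?_ ht (self_mem_Ici)
      · exact h.trans (hWb α)
      · intro y hy
        have h0 : HasDerivAt (fun t => W (α, t)) 0 y := by
          have := hW' α y; rwa [ph_right hy, mul_zero] at this
        have := h0.hasFDerivAt.hasFDerivWithinAt.fderivWithin (uniqueDiffOn_Ici b y hy)
        rw [this]; ext; simp
    · simp [gg_right r a b k α t ht]
  · rintro (_ | k) α t hi ht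
    · omega
    · simp [gg_left r a b k α t ht]
  · intro α t ht
    have : Convex ℝ (Iic a) := convex_Iic a
    refine this.is_const_of_fderivWithin_eq_zero (𝕜 := ℝ) (f := fun t => W (α, t))
        (hdiff α).differentiableOn ?_ ht (self_mem_Iic)
    intro y hy
    have h0 : HasDerivAt (fun t => W (α, t)) 0 y := by
      have := hW' α y; rwa [ph_left hy, mul_zero] at this
    have := h0.hasFDerivAt.hasFDerivWithinAt.fderivWithin (uniqueDiffOn_Iic a y hy)
    rw [this]; ext; simp

theorem ph_zero_of_eq {r : ℕ} {a b α : ℝ} {W : ℝ → ℝ}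
    (hW : ∀ t, HasDerivAt W (vv a b (α, t) ^ (2 * r) * ph a b t) t)
    {t₁ t₂ : ℝ} (he : W t₁ = W t₂) : ∀ t ∈ Ioo t₁ t₂, ph a b t = 0 := by
  have hmono : Monotone W := monotone_of_deriv_nonneg (fun t => (hW t).differentiableAt)
    (fun t => by
      rw [(hW t).deriv, pow_mul]
      exact mul_nonneg (pow_nonneg (sq_nonneg _) _) (ph_nonneg a b t))
  have hconst : ∀ t ∈ Ioo t₁ t₂, W t = W t₁ := fun t ht =>
    le_antisymm (by rw [he]; exact hmono ht.2.le) (hmono ht.1.le)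
  have hz : ∀ t ∈ Ioo t₁ t₂, vv a b (α, t) ^ (2 * r) * ph a b t = 0 := by
    intro t ht
    have h0 : HasDerivAt W 0 t := (hasDerivAt_const t (W t₁)).congr_of_eventuallyEq
      (by filter_upwards [Ioo_mem_nhds ht.1 ht.2] with y hy using hconst y hy)
    exact (hW t).unique h0
  intro t ht
  by_contra hne
  refine hne (key (α := α) ?_)
  filter_upwards [Ioo_mem_nhds ht.1 ht.2, (ph_diff a b).continuous.continuousAt.eventually_ne hne]
    with y hy hy'
  have h3 := (mul_eq_zero.1 (hz y hy)).resolve_right hy'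
  by_contra h4
  exact pow_ne_zero _ h4 h3

end Swallow

/-- Existence of swallowtail families of bump functions (del Pino–Toussaint, Proposition 8.7),
with the `O(1/N)` estimate in `ε`-form and the singularity classification weakened to the
multi-section conditions. -/
theorem swallowtail_family_of_bump_functions_exists
    (r : ℕ) (hr : 1 ≤ r) (a b ε : ℝ) (hab : a < b) (hε : 0 < ε) :
    ∃ (x : ℝ × ℝ → ℝ) (z : ℕ → ℝ × ℝ → ℝ) (h : ℝ → ℝ),
      -- jointly smooth data
      ContDiff ℝ (⊤ : ℕ∞) x ∧ (∀ i ≤ r, ContDiff ℝ (⊤ : ℕ∞) (z i)) ∧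
      ContDiff ℝ (⊤ : ℕ∞) h ∧
      -- h : ℝ → [0,1] with h = 0 for s ≤ 0 and h = 1 for s ≥ 1
      (∀ s : ℝ, 0 ≤ h s ∧ h s ≤ 1) ∧ (∀ s ≤ (0 : ℝ), h s = 0) ∧ (∀ s : ℝ, 1 ≤ s → h s = 1) ∧
      -- (a) the zero section for s ≤ 0
      (∀ s ≤ (0 : ℝ), ∀ t : ℝ, x (s, t) = t ∧ ∀ i ≤ r, z i (s, t) = 0) ∧
      -- (b) boundary condition for t ≥ b
      (∀ s t : ℝ, b ≤ t → x (s, t) = t ∧ ∀ i ≤ r, z i (s, t) = 0) ∧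
      -- (c) boundary condition for t ≤ a
      (∀ s t : ℝ, t ≤ a → x (s, t) = t ∧ z 0 (s, t) = h s ∧
        ∀ i, 1 ≤ i → i ≤ r → z i (s, t) = 0) ∧
      -- (d) fibrewise integrality
      (∀ i < r, ∀ s t : ℝ,
        deriv (fun t' => z i (s, t')) t = z (i + 1) (s, t) * deriv (fun t' => x (s, t')) t) ∧
      -- (e) every front is injective
      (∀ s : ℝ, Function.Injective (fun t => (x (s, t), z 0 (s, t)))) ∧
      -- (f) every fibre is graphical on a dense set
      (∀ s : ℝ, Dense {t : ℝ | deriv (fun t' => x (s, t')) t ≠ 0}) ∧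
      -- (g) small lifted coordinates
      (∀ i, 1 ≤ i → i ≤ r → ∀ s t : ℝ, |z i (s, t)| < ε) := by
  obtain ⟨Z, hZ, hZd, hZ0, hZr, hZl, hZc⟩ := Swallow.exists_Z r hr a b
  have hI : ∀ α, Z 0 (α, a) ≠ 0 := by
    intro α h0
    have := Swallow.ph_zero_of_eq (hZ0 α) (h0.trans (hZr 0 α b le_rfl).symm)
      ((a + b) / 2) ⟨by linarith, by linarith⟩
    exact (Swallow.ph_pos (a := a) (b := b) (t := (a + b) / 2)
      (by linarith) (by linarith)).ne' this
  -- uniform bound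
  have hIs : ContDiff ℝ (⊤ : ℕ∞) (fun α => Z 0 (α, a)) :=
    (hZ 0).comp (contDiff_id.prodMk contDiff_const)
  have hK : ∃ K : ℝ, 0 ≤ K ∧ ∀ i, 1 ≤ i → i ≤ r → ∀ α ∈ Icc (0 : ℝ) 1, ∀ t : ℝ,
      |Z i (α, t) / Z 0 (α, a)| ≤ K := by
    have h1 : ∀ i, ∃ C : ℝ, 0 ≤ C ∧ (1 ≤ i → ∀ α ∈ Icc (0 : ℝ) 1, ∀ t : ℝ,
        |Z i (α, t) / Z 0 (α, a)| ≤ C) := by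
      intro i
      have hc : Continuous (fun p : ℝ × ℝ => Z i p / Z 0 (p.1, a)) :=
        (hZ i).continuous.div (hIs.continuous.comp continuous_fst) (fun p => hI p.1)
      obtain ⟨C, hC⟩ := (isCompact_Icc.prod isCompact_Icc :
        IsCompact (Icc (0 : ℝ) 1 ×ˢ Icc a b)).exists_bound_of_continuousOn hc.continuousOn
      refine ⟨max C 0, le_max_right _ _, fun hi α hα t => ?_⟩
      by_cases h2 : t ≤ a
      · simp [hZl i α t hi h2]
      by_cases h3 : b ≤ t
      · simp [hZr i α t h3]
      exact le_trans (hC (α, t) ⟨hα, (not_le.1 h2).le, (not_le.1 h3).le⟩) (le_max_left _ _)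
    choose C hC hC' using h1
    refine ⟨∑ i ∈ Finset.range (r + 1), C i, Finset.sum_nonneg fun i _ => hC i, ?_⟩
    intro i hi hir α hα t
    exact (hC' i hi α hα t).trans (Finset.single_le_sum (f := C) (fun j _ => hC j)
      (Finset.mem_range.2 (by omega)))
  obtain ⟨K, hK0, hK⟩ := hK
  obtain ⟨η, hη0, hη1, hηK⟩ : ∃ η : ℝ, 0 < η ∧ η < 1 ∧ η * K < ε := by
    have hp : 0 < K + ε + 1 := by linarith
    refine ⟨ε / (K + ε + 1), div_pos hε hp, (div_lt_one hp).2 (by linarith), ?_⟩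
    rw [div_mul_eq_mul_div, div_lt_iff₀ hp]
    nlinarith [mul_nonneg hε.le hK0, mul_pos hε hε]
  have hS : ContDiff ℝ (⊤ : ℕ∞) Real.smoothTransition := Real.smoothTransition.contDiff
  obtain ⟨A, hA, hAI, hA0, hA1⟩ : ∃ A : ℝ → ℝ, ContDiff ℝ (⊤ : ℕ∞) A ∧
      (∀ s, η ≤ A s ∧ A s ≤ 1) ∧ (∀ s ≤ 0, A s = 1) ∧ (∀ s, 1 / 2 ≤ s → A s = η) := by
    refine ⟨fun s => 1 - (1 - η) * Real.smoothTransition (2 * s), ?_, ?_, ?_, ?_⟩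
    · exact contDiff_const.sub (contDiff_const.mul (hS.comp (contDiff_const.mul contDiff_id)))
    · intro s
      have h1 := Real.smoothTransition.nonneg (2 * s)
      have h2 := Real.smoothTransition.le_one (2 * s)
      constructor <;> nlinarith
    · intro s hs
      simp [Real.smoothTransition.zero_of_nonpos (show 2 * s ≤ 0 by linarith)]
    · intro s hs
      simp [Real.smoothTransition.one_of_one_le (show 1 ≤ 2 * s by linarith)]
  obtain ⟨h, hh, hhI, hh0, hh1, hhp, hhη⟩ : ∃ h : ℝ → ℝ, ContDiff ℝ (⊤ : ℕ∞) h ∧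
      (∀ s, 0 ≤ h s ∧ h s ≤ 1) ∧ (∀ s ≤ 0, h s = 0) ∧ (∀ s, 1 ≤ s → h s = 1) ∧
      (∀ s, 0 < s → 0 < h s) ∧ (∀ s ≤ 1 / 2, h s ≤ η) := by
    refine ⟨fun s => η * Real.smoothTransition s + (1 - η) * Real.smoothTransition (2 * s - 1),
      ?_, ?_, ?_, ?_, ?_, ?_⟩
    · exact (contDiff_const.mul hS).add (contDiff_const.mul
        (hS.comp ((contDiff_const.mul contDiff_id).sub contDiff_const)))
    · intro s
      have h1 := Real.smoothTransition.nonneg (2 * s - 1)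
      have h2 := Real.smoothTransition.le_one (2 * s - 1)
      have h3 := Real.smoothTransition.nonneg s
      have h4 := Real.smoothTransition.le_one s
      constructor <;> nlinarith
    · intro s hs
      simp [Real.smoothTransition.zero_of_nonpos hs,
        Real.smoothTransition.zero_of_nonpos (show 2 * s - 1 ≤ 0 by linarith)]
    · intro s hs
      simp [Real.smoothTransition.one_of_one_le hs,
        Real.smoothTransition.one_of_one_le (show 1 ≤ 2 * s - 1 by linarith)]
    · intro s hs
      have h1 := Real.smoothTransition.nonneg (2 * s - 1)
      have h2 := Real.smoothTransition.pos_of_pos hs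
      have h3 : 0 < η * Real.smoothTransition s := mul_pos hη0 h2
      have h4 : 0 ≤ (1 - η) * Real.smoothTransition (2 * s - 1) :=
        mul_nonneg (by linarith) h1
      linarith
    · intro s hs
      have h4 := Real.smoothTransition.le_one s
      simp only [Real.smoothTransition.zero_of_nonpos (show 2 * s - 1 ≤ 0 by linarith)]
      nlinarith
  have hAp : ∀ s, 0 < A s := fun s => hη0.trans_le (hAI s).1
  have hxd : ∀ s t, HasDerivAt (fun t => t + ((A s)⁻¹ - 1) * Swallow.ph a b t)
      (Swallow.vv a b (A s, t) / A s) t := by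
    intro s t
    refine HasDerivAt.congr_deriv ((hasDerivAt_id t).add
      (((Swallow.ph_diff a b) t).hasDerivAt.const_mul ((A s)⁻¹ - 1))) ?_
    have := (hAp s).ne'
    simp only [Swallow.vv]
    field_simp
  have hzs : ∀ i, ContDiff ℝ (⊤ : ℕ∞)
      (fun p : ℝ × ℝ => h p.1 * A p.1 ^ i * (Z i (A p.1, p.2) / Z 0 (A p.1, a))) := fun i =>
    ((hh.comp contDiff_fst).mul ((hA.comp contDiff_fst).pow i)).mul
      (((hZ i).comp ((hA.comp contDiff_fst).prodMk contDiff_snd)).div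
        (hIs.comp (hA.comp contDiff_fst)) (fun p => hI _))
  refine ⟨fun p => p.2 + ((A p.1)⁻¹ - 1) * Swallow.ph a b p.2,
    fun i p => h p.1 * A p.1 ^ i * (Z i (A p.1, p.2) / Z 0 (A p.1, a)), h,
    ?_, fun i _ => hzs i, hh, hhI, hh0, hh1, ?_, ?_, ?_, ?_, ?_, ?_, ?_⟩
  · exact contDiff_snd.add ((((hA.comp contDiff_fst).inv (fun p => (hAp p.1).ne')).sub
      contDiff_const).mul ((Swallow.ph_contDiff a b).comp contDiff_snd))
  · intro s hs t
    simp [hA0 s hs, hh0 s hs]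
  · intro s t ht
    refine ⟨by simp [Swallow.ph_right ht], fun i _ => by simp [hZr i (A s) t ht]⟩
  · intro s t ht
    refine ⟨by simp [Swallow.ph_left ht], ?_, fun i hi _ => by simp [hZl i (A s) t hi ht]⟩
    simp [hZc (A s) t ht, div_self (hI (A s))]
  · intro i hi s t
    have h1 := ((hZd i hi (A s) t).div_const (Z 0 (A s, a))).const_mul (h s * A s ^ i)
    have e1 := h1.deriv
    have e2 := (hxd s t).deriv
    simp only at e1 e2 ⊢
    rw [e1, e2]
    have := (hAp s).ne'
    have := hI (A s)
    field_simp
    ring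
  · intro s t₁ t₂ he
    simp only [Prod.mk.injEq] at he
    obtain ⟨hx, hz⟩ := he
    rcases le_or_gt s 0 with hs | hs
    · simpa [hA0 s hs] using hx
    · have hz' : Z 0 (A s, t₁) = Z 0 (A s, t₂) := by
        have h1 := mul_left_cancel₀ (by simpa using (hhp s hs).ne') hz
        exact (div_left_inj' (hI (A s))).1 h1
      have main : ∀ u w : ℝ, u < w → Z 0 (A s, u) = Z 0 (A s, w) →
          Swallow.ph a b u = 0 ∧ Swallow.ph a b w = 0 := by
        intro u w huw hE
        have h1 := Swallow.ph_zero_of_eq (hZ0 (A s)) hE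
        have hcl : IsClosed {t | Swallow.ph a b t = 0} :=
          isClosed_eq (Swallow.ph_diff a b).continuous continuous_const
        have h2 : closure (Ioo u w) ⊆ {t | Swallow.ph a b t = 0} :=
          closure_minimal h1 hcl
        rw [closure_Ioo huw.ne] at h2
        exact ⟨h2 (left_mem_Icc.2 huw.le), h2 (right_mem_Icc.2 huw.le)⟩
      rcases lt_trichotomy t₁ t₂ with hlt | heq | hlt
      · obtain ⟨p1, p2⟩ := main _ _ hlt hz'
        simpa [p1, p2] using hx
      · exact heq
      · obtain ⟨p1, p2⟩ := main _ _ hlt hz'.symm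
        simpa [p1, p2] using hx
  · intro s
    have e : {t : ℝ | deriv (fun t' => t' + ((A s)⁻¹ - 1) * Swallow.ph a b t') t ≠ 0}
        = {t : ℝ | Swallow.vv a b (A s, t) = 0}ᶜ := by
      ext t
      simp [(hxd s t).deriv, (hAp s).ne']
    change Dense {t : ℝ | deriv (fun t' => t' + ((A s)⁻¹ - 1) * Swallow.ph a b t') t ≠ 0}
    rw [e, ← interior_eq_empty_iff_dense_compl, eq_empty_iff_forall_notMem]
    intro t ht
    have hv : ∀ᶠ y in 𝓝 t, Swallow.vv a b (A s, y) = 0 := mem_interior_iff_mem_nhds.1 ht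
    have hph : Swallow.ph a b =ᶠ[𝓝 t] fun _ => 0 := by
      filter_upwards [hv.eventually_nhds] with y hy using Swallow.key hy
    have hd : deriv (Swallow.ph a b) t = 0 := by rw [hph.deriv_eq]; simp
    have := hv.self_of_nhds
    simp [Swallow.vv, hd] at this
    exact (hAp s).ne' this
  · intro i hi hir s t
    have hk := hK i hi hir (A s) ⟨(hAp s).le, (hAI s).2⟩ t
    have hpow : A s ^ i ≤ A s := pow_le_of_le_one (hAp s).le (hAI s).2 (by omega)
    have hpow0 : 0 ≤ A s ^ i := pow_nonneg (hAp s).le i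
    have hη : h s * A s ^ i ≤ η := by
      rcases le_total s (1 / 2) with hs | hs
      · have := hhη s hs
        calc h s * A s ^ i ≤ η * 1 :=
              mul_le_mul this (hpow.trans (hAI s).2) hpow0 hη0.le
          _ = η := mul_one η
      · have := hA1 s hs
        calc h s * A s ^ i ≤ 1 * η :=
              mul_le_mul (hhI s).2 (hpow.trans this.le) hpow0 zero_le_one
          _ = η := one_mul η
    simp only
    rw [abs_mul, abs_of_nonneg (mul_nonneg (hhI s).1 hpow0)]
    exact (mul_le_mul hη hk (abs_nonneg _) hη0.le).trans_lt hηK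
end

section
/- (The closed double fold is embedded although its metasymplectic projection is not; Subsection 6.5 of del Pino–Toussaint.) The map g : ℝ → ℝ², g(t) = (t³/3 − t, t²), is not injective: g(√3) = g(−√3) = (0, 3). Its once-integrated lift, namely the map G : ℝ → ℝ³ given by G(t) = (t³/3 − t, t⁵/5 − t³/3, t²) — where the middle coordinate z_{r−1}(t) = ∫₀ᵗ s²(s²−1) ds is the primitive of z_r · x' with z_r(t) = t² and x(t) = t³/3 − t — is injective and has nowhere-vanishing derivative. Hence the double point of the principal projection of the closed double fold disappears upon lifting, and the closed double fold lifts to an injective integral immersion. -/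
/-- The closed double fold is embedded although its metasymplectic projection is not
(del Pino–Toussaint, Subsection 6.5). -/
theorem closed_double_fold_embedded
    (g : ℝ → ℝ × ℝ) (hg : g = fun t => (t ^ 3 / 3 - t, t ^ 2))
    (G : ℝ → ℝ × ℝ × ℝ)
    (hG : G = fun t => (t ^ 3 / 3 - t, t ^ 5 / 5 - t ^ 3 / 3, t ^ 2)) :
    -- the metasymplectic projection is not injective
    ¬ Function.Injective g ∧
    g (Real.sqrt 3) = (0, 3) ∧ g (-Real.sqrt 3) = (0, 3) ∧
    -- the middle coordinate of G is the primitive of z_r · x'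
    (∀ t : ℝ, t ^ 5 / 5 - t ^ 3 / 3 = ∫ s in (0:ℝ)..t, s ^ 2 * (s ^ 2 - 1)) ∧
    -- the lift is an injective immersion
    Function.Injective G ∧
    (∀ t : ℝ, deriv G t ≠ 0) := by
  have h3 : Real.sqrt 3 ^ 2 = 3 := Real.sq_sqrt (by norm_num)
  have hpos : 0 < Real.sqrt 3 := Real.sqrt_pos.mpr (by norm_num)
  have e1 : g (Real.sqrt 3) = (0, 3) := by
    rw [hg]
    refine Prod.ext ?_ h3
    show Real.sqrt 3 ^ 3 / 3 - Real.sqrt 3 = 0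
    linear_combination (Real.sqrt 3 / 3) * h3
  have e2 : g (-Real.sqrt 3) = (0, 3) := by
    rw [hg]
    refine Prod.ext ?_ ?_
    · show (-Real.sqrt 3) ^ 3 / 3 - (-Real.sqrt 3) = 0
      linear_combination (-Real.sqrt 3 / 3) * h3
    · show (-Real.sqrt 3) ^ 2 = 3
      linear_combination h3
  have d1 : ∀ t : ℝ, HasDerivAt (fun t : ℝ => t ^ 3 / 3 - t) (t ^ 2 - 1) t := by
    intro t
    refine HasDerivAt.congr_deriv (((hasDerivAt_pow 3 t).div_const 3).sub (hasDerivAt_id t)) ?_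
    push_cast
    ring
  have d2 : ∀ t : ℝ, HasDerivAt (fun t : ℝ => t ^ 5 / 5 - t ^ 3 / 3) (t ^ 2 * (t ^ 2 - 1)) t := by
    intro t
    refine HasDerivAt.congr_deriv (((hasDerivAt_pow 5 t).div_const 5).sub ((hasDerivAt_pow 3 t).div_const 3)) ?_
    push_cast
    ring
  have d3 : ∀ t : ℝ, HasDerivAt (fun t : ℝ => t ^ 2) (2 * t) t := by
    intro t
    refine HasDerivAt.congr_deriv (hasDerivAt_pow 2 t) ?_
    push_cast
    ring
  refine ⟨fun h => ?_, e1, e2, fun t => ?_, ?_, fun t => ?_⟩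
  · have := h (e1.trans e2.symm)
    linarith
  · rw [intervalIntegral.integral_eq_sub_of_hasDerivAt (fun x _ => d2 x)
      (Continuous.intervalIntegrable (by fun_prop) _ _)]
    norm_num
  · intro a b hab
    rw [hG] at hab
    simp only [Prod.mk.injEq] at hab
    obtain ⟨h1, h2, h4⟩ := hab
    rcases sq_eq_sq_iff_eq_or_eq_neg.mp h4 with h | h
    · exact h
    · subst h
      have hb : b = 0 := by
        by_contra hb
        have k1 : b * (b ^ 2 - 3) = 0 := by linear_combination (-3 / 2) * h1
        have k2 : b ^ 3 * (b ^ 2 / 5 - 1 / 3) = 0 := by linear_combination (-1 / 2) * h2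
        have k3 := (mul_eq_zero.mp k1).resolve_left hb
        have k4 := (mul_eq_zero.mp k2).resolve_left (pow_ne_zero 3 hb)
        linarith
      simp [hb]
  · have hd : HasDerivAt G (t ^ 2 - 1, t ^ 2 * (t ^ 2 - 1), 2 * t) t := by
      rw [hG]
      exact (d1 t).prodMk ((d2 t).prodMk (d3 t))
    rw [hd.deriv]
    intro h
    simp only [Prod.mk_eq_zero] at h
    obtain ⟨h1, -, h2⟩ := h
    have ht : t = 0 := by linarith
    rw [ht] at h1
    norm_num at h1
end
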